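/- arXiv:1402.1199 — 3 statements merged into one kernel-verified Lean document; each statement's English description precedes it below -/
import Mathlib

section
/- Let d, m, n, r be positive integers with m ≥ 8d, n ≥ 8d, 2d ≤ r and 2r ≤ mn. Then p_r(m,n) − p_{r−1}(m,n) ≥ d. -/
/-- `gaussP m n r` is the number of partitions of `r` into at most `m` parts,
each part of size at most `n` (the coefficient of `q^r` in the Gaussian
binomial coefficient `binom(m+n, m)_q`). -/
def gaussP (m n r : ℕ) : ℕ :=
  (Finset.univ.filter fun f : Fin m → Fin (n + 1) =>
    (∀ i j : Fin m, i ≤ j → f j ≤ f i) ∧ ∑ i, (f i : ℕ) = r).card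

/-- multisets of `m` numbers, each at most `n`, with sum `r` -/
def MS (m n r : ℕ) : Set (Multiset ℕ) :=
  {s | Multiset.card s = m ∧ (∀ x ∈ s, x ≤ n) ∧ s.sum = r}

/-- the multiset of values of a function -/
def valMS {m n : ℕ} (f : Fin m → Fin (n + 1)) : Multiset ℕ :=
  (List.ofFn fun i => (f i : ℕ) : List ℕ)

lemma MS_eq_image (m n r : ℕ) :
    MS m n r = valMS '' (↑(Finset.univ.filter fun f : Fin m → Fin (n + 1) =>
    (∀ i j : Fin m, i ≤ j → f j ≤ f i) ∧ ∑ i, (f i : ℕ) = r) : Set (Fin m → Fin (n + 1))) := by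
  ext s
  constructor
  · rintro ⟨h1, h2, h3⟩
    have hl : (s.sort (· ≥ ·)).length = m := by simp [h1]
    have hp : (s.sort (· ≥ ·)).Pairwise (· ≥ ·) := Multiset.pairwise_sort s _
    have hs : ((s.sort (· ≥ ·) : List ℕ) : Multiset ℕ) = s := Multiset.sort_eq s _
    generalize s.sort (· ≥ ·) = l at hl hp hs
    subst hl
    have h4 : ∀ i : Fin l.length, l.get i < n + 1 := fun i =>
      Nat.lt_succ_of_le (h2 _ (by rw [← hs]; simp))
    refine ⟨fun i => ⟨l.get i, h4 i⟩, ?_, ?_⟩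
    · simp only [Finset.coe_filter, Finset.mem_univ, true_and, Set.mem_ofPred_eq, Fin.mk_le_mk]
      constructor
      · intro i j hij
        rcases hij.eq_or_lt with h | h
        · rw [h]
        · exact List.pairwise_iff_get.1 hp i j h
      · rw [← h3, ← hs, Multiset.sum_coe, ← List.sum_ofFn]
        simp
    · simp only [valMS, List.ofFn_get]
      exact hs
  · rintro ⟨f, hf, rfl⟩
    simp only [Finset.coe_filter, Finset.mem_univ, true_and, Set.mem_ofPred_eq] at hf
    refine ⟨by simp [valMS], ?_, ?_⟩
    · intro x hx
      simp only [valMS, Multiset.mem_coe, List.mem_ofFn] at hx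
      obtain ⟨i, rfl⟩ := hx
      exact Nat.le_of_lt_succ (f i).2
    · simp [valMS, List.sum_ofFn, hf.2]

lemma valMS_injOn (m n r : ℕ) : Set.InjOn valMS (↑(Finset.univ.filter fun f : Fin m → Fin (n + 1) =>
    (∀ i j : Fin m, i ≤ j → f j ≤ f i) ∧ ∑ i, (f i : ℕ) = r) : Set (Fin m → Fin (n + 1))) := by
  intro f hf g hg hfg
  simp only [Finset.coe_filter, Finset.mem_univ, true_and, Set.mem_ofPred_eq] at hf hg
  have h := Multiset.coe_eq_coe.1 hfg
  have hs : ∀ f : Fin m → Fin (n + 1), (∀ i j : Fin m, i ≤ j → f j ≤ f i) →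
      (List.ofFn fun i => (f i : ℕ)).Pairwise (· ≥ ·) := by
    intro f hf
    rw [List.pairwise_ofFn]
    intro i j hij
    exact hf i j hij.le
  have h2 := h.eq_of_pairwise (fun a b _ _ h1 h2 => le_antisymm h2 h1) (hs f hf.1) (hs g hg.1)
  have h3 := List.ofFn_injective h2
  funext i
  exact Fin.ext (congrFun h3 i)

lemma MS_finite (m n r : ℕ) : (MS m n r).Finite := by
  rw [MS_eq_image]; exact (Finset.finite_toSet _).image _

lemma gaussP_eq (m n r : ℕ) : gaussP m n r = (MS m n r).ncard := by
  rw [MS_eq_image, (valMS_injOn m n r).ncard_image, Set.ncard_coe_finset]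
  rfl

lemma MS_zero_left (n r : ℕ) : (MS 0 n r).ncard = if r = 0 then 1 else 0 := by
  split_ifs with h
  · subst h
    rw [Set.ncard_eq_one]
    refine ⟨0, ?_⟩
    ext s
    simp only [MS, Set.mem_ofPred_eq, Set.mem_singleton_iff, Multiset.card_eq_zero]
    constructor
    · exact fun h => h.1
    · rintro rfl; simp
  · convert Set.ncard_empty (Multiset ℕ)
    ext s
    simp only [MS, Set.mem_ofPred_eq, Multiset.card_eq_zero, Set.mem_empty_iff_false, iff_false]
    rintro ⟨rfl, -, h2⟩
    exact h (by simpa using h2.symm)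

lemma MS_zero_right (m r : ℕ) : (MS m 0 r).ncard = if r = 0 then 1 else 0 := by
  have key : ∀ s, s ∈ MS m 0 r → s = Multiset.replicate m 0 ∧ r = 0 := by
    rintro s ⟨h1, h2, h3⟩
    have h4 : s = Multiset.replicate m 0 :=
      Multiset.eq_replicate.2 ⟨h1, fun b hb => Nat.le_zero.1 (h2 b hb)⟩
    refine ⟨h4, ?_⟩
    rw [← h3, h4]; simp
  split_ifs with h
  · subst h
    rw [Set.ncard_eq_one]
    refine ⟨Multiset.replicate m 0, ?_⟩
    ext s
    constructor
    · exact fun h => (key s h).1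
    · rintro rfl
      refine ⟨by simp, ?_, by simp⟩
      intro x hx
      exact (Multiset.eq_of_mem_replicate hx).le
  · convert Set.ncard_empty (Multiset ℕ)
    ext s
    simp only [Set.mem_empty_iff_false, iff_false]
    intro hs
    exact h (key s hs).2

/-- remove a largest part -/
lemma MS_rec1 (m n r : ℕ) : (MS (m + 1) (n + 1) r).ncard =
    (MS (m + 1) n r).ncard + if n + 1 ≤ r then (MS m (n + 1) (r - (n + 1))).ncard else 0 := by
  have h1 : MS (m + 1) (n + 1) r = MS (m + 1) n r ∪ {s | s ∈ MS (m + 1) (n + 1) r ∧ n + 1 ∈ s} := by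
    ext s
    constructor
    · rintro ⟨a, b, c⟩
      by_cases h : n + 1 ∈ s
      · exact Or.inr ⟨⟨a, b, c⟩, h⟩
      · refine Or.inl ⟨a, fun x hx => ?_, c⟩
        have := b x hx
        have h' : x ≠ n + 1 := fun e => h (e ▸ hx)
        omega
    · rintro (⟨a, b, c⟩ | h)
      · exact ⟨a, fun x hx => (b x hx).trans (Nat.le_succ n), c⟩
      · exact h.1
  have hd : Disjoint (MS (m + 1) n r) {s | s ∈ MS (m + 1) (n + 1) r ∧ n + 1 ∈ s} := by
    rw [Set.disjoint_left]
    rintro s ⟨a, b, c⟩ ⟨-, h⟩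
    have := b _ h
    omega
  have h2 : {s | s ∈ MS (m + 1) (n + 1) r ∧ n + 1 ∈ s} =
      (fun t => (n + 1) ::ₘ t) '' (if n + 1 ≤ r then MS m (n + 1) (r - (n + 1)) else ∅) := by
    ext s
    constructor
    · rintro ⟨⟨a, b, c⟩, h⟩
      obtain ⟨t, rfl⟩ := Multiset.exists_cons_of_mem h
      simp only [Multiset.card_cons, Multiset.sum_cons] at a c
      rw [if_pos (by omega)]
      refine ⟨t, ⟨by omega, fun x hx => b x (Multiset.mem_cons_of_mem hx), by omega⟩, rfl⟩
    · rintro ⟨t, ht, rfl⟩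
      split_ifs at ht with h
      · obtain ⟨a, b, c⟩ := ht
        refine ⟨⟨by simp [a], ?_, by simp [c]; omega⟩, by simp⟩
        intro x hx
        rcases Multiset.mem_cons.1 hx with rfl | hx
        · exact le_rfl
        · exact b x hx
      · exact ht.elim
  rw [h1, Set.ncard_union_eq hd (MS_finite _ _ _)
    ((MS_finite (m+1) (n+1) r).subset fun s hs => hs.1), h2,
    Set.ncard_image_of_injective _ (fun a b h => (Multiset.cons_inj_right _).1 h)]
  split_ifs <;> simp

/-- remove a smallest part, or subtract one from each part -/
lemma MS_rec2 (m n r : ℕ) : (MS (m + 1) (n + 1) r).ncard =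
    (MS m (n + 1) r).ncard + if m + 1 ≤ r then (MS (m + 1) n (r - (m + 1))).ncard else 0 := by
  have h1 : MS (m + 1) (n + 1) r =
      (fun t => 0 ::ₘ t) '' (MS m (n + 1) r) ∪ (fun t => t.map Nat.succ) ''
        (if m + 1 ≤ r then MS (m + 1) n (r - (m + 1)) else ∅) := by
    ext s
    constructor
    · rintro ⟨a, b, c⟩
      by_cases h : 0 ∈ s
      · left
        obtain ⟨t, rfl⟩ := Multiset.exists_cons_of_mem h
        simp only [Multiset.card_cons, Multiset.sum_cons] at a c
        exact ⟨t, ⟨by omega, fun x hx => b x (Multiset.mem_cons_of_mem hx), by omega⟩, rfl⟩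
      · right
        have hs : (s.map Nat.pred).map Nat.succ = s := by
          rw [Multiset.map_map]
          conv_rhs => rw [← Multiset.map_id s]
          apply Multiset.map_congr rfl
          intro x hx
          have : x ≠ 0 := fun e => h (e ▸ hx)
          simp only [Function.comp, id]
          exact Nat.succ_pred this
        have hsum : s.sum = (s.map Nat.pred).sum + (m + 1) := by
          conv_lhs => rw [← hs]
          simp only [Nat.succ_eq_add_one]
          rw [Multiset.sum_map_add]
          simp [a, add_comm]
        rw [if_pos (by omega)]
        refine ⟨s.map Nat.pred, ⟨by simpa using a, ?_, by omega⟩, hs⟩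
        intro x hx
        obtain ⟨y, hy, rfl⟩ := Multiset.mem_map.1 hx
        have := b y hy
        simp only [Nat.pred_eq_sub_one]
        omega
    · rintro (⟨t, ⟨a, b, c⟩, rfl⟩ | ⟨t, ht, rfl⟩)
      · refine ⟨by simp [a], ?_, by simp [c]⟩
        intro x hx
        rcases Multiset.mem_cons.1 hx with rfl | hx
        · exact Nat.zero_le _
        · exact b x hx
      · split_ifs at ht with h
        · obtain ⟨a, b, c⟩ := ht
          refine ⟨by simp [a], ?_, ?_⟩
          · intro x hx
            obtain ⟨y, hy, rfl⟩ := Multiset.mem_map.1 hx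
            exact Nat.succ_le_succ (b y hy)
          · simp only [Nat.succ_eq_add_one]
            rw [Multiset.sum_map_add]
            simp [a, c]; omega
        · exact ht.elim
  have hd : Disjoint ((fun t => (0:ℕ) ::ₘ t) '' (MS m (n + 1) r)) ((fun t => t.map Nat.succ) ''
        (if m + 1 ≤ r then MS (m + 1) n (r - (m + 1)) else ∅)) := by
    rw [Set.disjoint_left]
    rintro s ⟨t, -, rfl⟩ ⟨u, -, h⟩
    have h0 : (0:ℕ) ∈ u.map Nat.succ := by
      have : (0:ℕ) ∈ (0:ℕ) ::ₘ t := Multiset.mem_cons_self _ _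
      exact (show u.map Nat.succ = 0 ::ₘ t from h) ▸ this
    obtain ⟨y, -, hy⟩ := Multiset.mem_map.1 h0
    exact Nat.succ_ne_zero y hy
  have hf : (if m + 1 ≤ r then MS (m + 1) n (r - (m + 1)) else ∅).Finite := by
    split_ifs
    · exact MS_finite _ _ _
    · exact Set.finite_empty
  rw [h1, Set.ncard_union_eq hd ((MS_finite _ _ _).image _) (hf.image _),
    Set.ncard_image_of_injective _ (fun a b h => (Multiset.cons_inj_right _).1 h),
    Set.ncard_image_of_injective _ (Multiset.map_injective Nat.succ_injective)]
  split_ifs <;> simp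

lemma gaussP_symm (m n r : ℕ) : gaussP m n r = gaussP n m r := by
  rw [gaussP_eq, gaussP_eq]
  induction m generalizing n r with
  | zero => rw [MS_zero_left, MS_zero_right]
  | succ m ihm =>
    induction n generalizing r with
    | zero => rw [MS_zero_left, MS_zero_right]
    | succ n ihn =>
      rw [MS_rec1 m n r, MS_rec2 n m r, ihn, ihm]

open MvPolynomial in
/-- leading exponents of a subspace -/
def LMset {σ : Type} (o : MonomialOrder σ) (V : Submodule ℚ (MvPolynomial σ ℚ)) : Set o.syn :=
  {x | ∃ f ∈ V, f ≠ 0 ∧ o.toSyn (o.degree f) = x}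

lemma LMset_spec {σ : Type} (o : MonomialOrder σ) (V : Submodule ℚ (MvPolynomial σ ℚ))
    [FiniteDimensional ℚ V] : (LMset o V).Finite ∧ (LMset o V).ncard = Module.finrank ℚ V := by
  classical
  have hch : ∀ x : LMset o V, ∃ f : V, (f : MvPolynomial σ ℚ) ≠ 0 ∧
      o.toSyn (o.degree (f : MvPolynomial σ ℚ)) = x := by
    rintro ⟨x, f, hf, h1, h2⟩
    exact ⟨⟨f, hf⟩, h1, h2⟩
  choose F hF0 hFd using hch
  have hli : LinearIndependent ℚ F := by
    rw [linearIndependent_iff']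
    intro s g hg i hi
    by_contra hne
    have hnonempty : (s.filter fun i => g i ≠ 0).Nonempty := ⟨i, by simp [hi, hne]⟩
    obtain ⟨j, hj, hmax⟩ := Finset.exists_max_image _ (fun i : LMset o V => (i : o.syn)) hnonempty
    rw [Finset.mem_filter] at hj
    have h0 : ∑ i ∈ s, g i • (F i : MvPolynomial σ ℚ) = 0 := by
      have := congrArg (Subtype.val) hg
      simpa using this
    have h1 := congrArg (MvPolynomial.coeff (o.degree (F j : MvPolynomial σ ℚ))) h0
    rw [MvPolynomial.coeff_sum, MvPolynomial.coeff_zero, Finset.sum_eq_single j] at h1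
    · rw [MvPolynomial.coeff_smul, smul_eq_mul, mul_eq_zero] at h1
      rcases h1 with h1 | h1
      · exact hj.2 h1
      · exact hF0 j (o.coeff_degree_eq_zero_iff.1 h1)
    · intro k hk hkj
      rw [MvPolynomial.coeff_smul, smul_eq_mul]
      by_cases hgk : g k = 0
      · simp [hgk]
      · have hle := hmax k (by simp [hk, hgk])
        have hlt : (k : o.syn) < j := lt_of_le_of_ne hle fun h => hkj (Subtype.ext h)
        rw [o.coeff_eq_zero_of_lt, mul_zero]
        rw [hFd, hFd]
        exact hlt
    · intro h; exact absurd hj.1 h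
  have hfin : Finite (LMset o V) := hli.finite
  have := Fintype.ofFinite (LMset o V)
  refine ⟨Set.toFinite _, le_antisymm ?_ ?_⟩
  · rw [← Nat.card_coe_set_eq, Nat.card_eq_fintype_card]
    exact hli.fintype_card_le_finrank
  · let φ : V →ₗ[ℚ] (LMset o V → ℚ) :=
      LinearMap.pi fun x => (MvPolynomial.lcoeff ℚ (o.toSyn.symm (x : o.syn))).comp V.subtype
    have hφ : Function.Injective φ := by
      rw [← LinearMap.ker_eq_bot, LinearMap.ker_eq_bot']
      intro f hf
      by_contra hne
      have hne' : (f : MvPolynomial σ ℚ) ≠ 0 := fun h => hne (Subtype.ext h)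
      have h2 := congrFun hf ⟨_, f, f.2, hne', rfl⟩
      simp [φ] at h2
      exact hne h2
    have := LinearMap.finrank_le_finrank_of_injective hφ
    rw [Module.finrank_fintype_fun_eq_card] at this
    rwa [← Nat.card_coe_set_eq, Nat.card_eq_fintype_card]

open Pointwise in
lemma finrank_mul {σ : Type} (o : MonomialOrder σ) (A B C : Submodule ℚ (MvPolynomial σ ℚ))
    [FiniteDimensional ℚ A] [FiniteDimensional ℚ B] [FiniteDimensional ℚ C]
    (h : ∀ a ∈ A, ∀ b ∈ B, a * b ∈ C) (hA : 0 < Module.finrank ℚ A)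
    (hB : 0 < Module.finrank ℚ B) :
    Module.finrank ℚ A + Module.finrank ℚ B ≤ Module.finrank ℚ C + 1 := by
  classical
  obtain ⟨fA, cA⟩ := LMset_spec o A
  obtain ⟨fB, cB⟩ := LMset_spec o B
  obtain ⟨fC, cC⟩ := LMset_spec o C
  rw [Set.ncard_eq_toFinset_card _ fA] at cA
  rw [Set.ncard_eq_toFinset_card _ fB] at cB
  rw [Set.ncard_eq_toFinset_card _ fC] at cC
  have nA : fA.toFinset.Nonempty := Finset.card_pos.1 (by omega)
  have nB : fB.toFinset.Nonempty := Finset.card_pos.1 (by omega)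
  have h1 := cauchy_davenport_add_of_linearOrder_isCancelAdd nA nB
  have h2 : fA.toFinset + fB.toFinset ⊆ fC.toFinset := by
    intro x hx
    obtain ⟨y, hy, z, hz, rfl⟩ := Finset.mem_add.1 hx
    rw [Set.Finite.mem_toFinset] at *
    obtain ⟨f, hf, f0, rfl⟩ := hy
    obtain ⟨g, hg, g0, rfl⟩ := hz
    exact ⟨f * g, h f hf g hg, mul_ne_zero f0 g0, by rw [o.degree_mul f0 g0, map_add]⟩
  have h3 := Finset.card_le_card h2
  omega

section sl2
variable {M : Type} [AddCommGroup M] [Module ℚ M] (D U : Module.End ℚ M)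
  (W : ℕ → Submodule ℚ M) (N : ℕ)

lemma sl2_aux (hU : ∀ r, ∀ v ∈ W r, U v ∈ W (r + 1))
    (hc : ∀ r, ∀ v ∈ W r, D (U v) - U (D v) = ((N : ℚ) - 2 * r) • v)
    (t : ℕ) (w : M) (hw : w ∈ W t) (hD : D w = 0) (k : ℕ) :
    (U ^ k) w ∈ W (t + k) ∧
    D ((U ^ (k + 1)) w) = (((k : ℚ) + 1) * ((N : ℚ) - 2 * t - k)) • (U ^ k) w := by
  induction k with
  | zero =>
    refine ⟨by simpa using hw, ?_⟩
    have := hc t w hw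
    simp only [hD, map_zero, sub_zero] at this
    simp [this]
  | succ k ih =>
    have h1 : (U ^ (k + 1)) w ∈ W (t + (k + 1)) := by
      rw [pow_succ', Module.End.mul_apply]
      exact hU _ _ ih.1
    refine ⟨h1, ?_⟩
    have h2 := hc _ _ h1
    have e : U ((U ^ k) w) = (U ^ (k + 1)) w := by rw [pow_succ', Module.End.mul_apply]
    rw [ih.2, map_smul, e, sub_eq_iff_eq_add] at h2
    rw [pow_succ', Module.End.mul_apply, h2, ← add_smul]
    congr 1
    push_cast
    ring

lemma sl2_aux2 (hU : ∀ r, ∀ v ∈ W r, U v ∈ W (r + 1))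
    (hc : ∀ r, ∀ v ∈ W r, D (U v) - U (D v) = ((N : ℚ) - 2 * r) • v)
    (t : ℕ) (w : M) (hw : w ∈ W t) (hD : D w = 0) (k : ℕ) (hk : 2 * t + k ≤ N) :
    ∃ c : ℚ, c ≠ 0 ∧ (D ^ k) ((U ^ k) w) = c • w := by
  induction k with
  | zero => exact ⟨1, one_ne_zero, by simp⟩
  | succ k ih =>
    obtain ⟨c, hc0, h⟩ := ih (by omega)
    refine ⟨(((k : ℚ) + 1) * ((N : ℚ) - 2 * t - k)) * c, ?_, ?_⟩
    · refine mul_ne_zero (mul_ne_zero (by positivity) ?_) hc0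
      have : (2 * t + (k + 1) : ℚ) ≤ N := by exact_mod_cast hk
      intro h; linarith
    · rw [pow_succ D, Module.End.mul_apply, (sl2_aux D U W N hU hc t w hw hD k).2, map_smul, h,
        smul_smul]

lemma sl2_surj (hD : ∀ r, ∀ v ∈ W (r + 1), D v ∈ W r) (hD0 : ∀ v ∈ W 0, D v = 0)
    (hU : ∀ r, ∀ v ∈ W r, U v ∈ W (r + 1))
    (hc : ∀ r, ∀ v ∈ W r, D (U v) - U (D v) = ((N : ℚ) - 2 * r) • v)
    (s : ℕ) (hs : 2 * s < N) (v : M) (hv : v ∈ W s) : ∃ u ∈ W (s + 1), D u = v := by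
  have hpow : ∀ k ≤ s, ∀ v ∈ W s, (D ^ k) v ∈ W (s - k) := by
    intro k
    induction k with
    | zero => intro _ v hv; simpa using hv
    | succ k ih =>
      intro hk v hv
      rw [pow_succ', Module.End.mul_apply]
      apply hD
      have := ih (by omega) v hv
      rwa [show s - (k + 1) + 1 = s - k by omega]
  have key : ∀ k ≤ s + 1, ∀ v ∈ W s, (D ^ k) v = 0 → ∃ u ∈ W (s + 1), D u = v := by
    intro k
    induction k with
    | zero =>
      intro _ v _ h
      exact ⟨0, Submodule.zero_mem _, by simpa using h.symm⟩
    | succ k ih =>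
      intro hk v hv h
      have hw := hpow k (by omega) v hv
      have hDw : D ((D ^ k) v) = 0 := by rwa [← Module.End.mul_apply, ← pow_succ']
      obtain ⟨c, hc0, hcw⟩ := sl2_aux2 D U W N hU hc _ _ hw hDw (k + 1) (by omega)
      have hm := (sl2_aux D U W N hU hc _ _ hw hDw (k + 1)).1
      rw [show s - k + (k + 1) = s + 1 by omega] at hm
      set y := (U ^ (k + 1)) ((D ^ k) v) with hy
      obtain ⟨u, hu, hu'⟩ := ih (by omega) (v - c⁻¹ • D y)
        (Submodule.sub_mem _ hv (Submodule.smul_mem _ _ (hD _ _ hm))) (by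
          rw [map_sub, map_smul, ← Module.End.mul_apply (D ^ k), ← pow_succ, hcw, smul_smul,
            inv_mul_cancel₀ hc0, one_smul, sub_self])
      refine ⟨u + c⁻¹ • y, Submodule.add_mem _ hu (Submodule.smul_mem _ _ hm), ?_⟩
      rw [map_add, hu', map_smul, sub_add_cancel]
  refine key (s + 1) le_rfl v hv ?_
  rw [pow_succ', Module.End.mul_apply]
  exact hD0 _ (by simpa using hpow s le_rfl v hv)

lemma sl2_finrank [∀ r, FiniteDimensional ℚ (W r)]
    (hD : ∀ r, ∀ v ∈ W (r + 1), D v ∈ W r) (hD0 : ∀ v ∈ W 0, D v = 0)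
    (hU : ∀ r, ∀ v ∈ W r, U v ∈ W (r + 1))
    (hc : ∀ r, ∀ v ∈ W r, D (U v) - U (D v) = ((N : ℚ) - 2 * r) • v)
    (s : ℕ) (hs : 2 * s < N) :
    Module.finrank ℚ (W s) + Module.finrank ℚ (W (s + 1) ⊓ LinearMap.ker D : Submodule ℚ M) =
      Module.finrank ℚ (W (s + 1)) := by
  have h := LinearMap.finrank_range_add_finrank_ker (D.domRestrict (W (s + 1)))
  have h1 : LinearMap.range (D.domRestrict (W (s + 1))) = W s := by
    ext v
    constructor
    · rintro ⟨u, rfl⟩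
      exact hD _ _ u.2
    · intro hv
      obtain ⟨u, hu, rfl⟩ := sl2_surj D U W N hD hD0 hU hc s hs v hv
      exact ⟨⟨u, hu⟩, rfl⟩
  have h2 : (W (s + 1) ⊓ LinearMap.ker D : Submodule ℚ M) =
      (LinearMap.ker (D.domRestrict (W (s + 1)))).map (W (s + 1)).subtype := by
    ext v
    simp only [Submodule.mem_inf, LinearMap.mem_ker, Submodule.mem_map]
    constructor
    · rintro ⟨a, b⟩
      exact ⟨⟨v, a⟩, b, rfl⟩
    · rintro ⟨u, a, rfl⟩
      exact ⟨u.2, a⟩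
  rw [h1] at h
  rw [h2, Submodule.finrank_map_subtype_eq, h]
end sl2


section poly
open MvPolynomial

/-- bigrading: degree and weight -/
def wt (n : ℕ) : Fin (n + 1) → ℕ × ℕ := fun i => (1, (i : ℕ))

/-- polynomials of degree `m` and weight `r` -/
noncomputable def Wsp (n m r : ℕ) : Submodule ℚ (MvPolynomial (Fin (n + 1)) ℚ) :=
  weightedHomogeneousSubmodule ℚ (wt n) (m, r)

/-- lowering derivation -/
noncomputable def Dd (n : ℕ) :
    Derivation ℚ (MvPolynomial (Fin (n + 1)) ℚ) (MvPolynomial (Fin (n + 1)) ℚ) :=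
  mkDerivation ℚ fun i => ((i : ℕ) : ℚ) • X (i - 1)

/-- raising derivation -/
noncomputable def Ud (n : ℕ) :
    Derivation ℚ (MvPolynomial (Fin (n + 1)) ℚ) (MvPolynomial (Fin (n + 1)) ℚ) :=
  mkDerivation ℚ fun i => ((n : ℚ) - (i : ℕ)) • X (i + 1)

/-- diagonal derivation -/
noncomputable def Hd (n : ℕ) :
    Derivation ℚ (MvPolynomial (Fin (n + 1)) ℚ) (MvPolynomial (Fin (n + 1)) ℚ) :=
  mkDerivation ℚ fun i => ((n : ℚ) - 2 * (i : ℕ)) • X i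

lemma fin_sub_one_val {n : ℕ} (i : Fin (n + 1)) (h : (i : ℕ) ≠ 0) :
    ((i - 1 : Fin (n + 1)) : ℕ) + 1 = i := by
  have h0 : i ≠ 0 := fun e => h (by simp [e])
  have := Fin.val_sub_one_of_ne_zero h0
  omega

lemma fin_add_one_val {n : ℕ} (i : Fin (n + 1)) (h : (i : ℕ) ≠ n) :
    ((i + 1 : Fin (n + 1)) : ℕ) = i + 1 :=
  Fin.val_add_one_of_lt' (by have := i.2; omega)

lemma comm_DU (n : ℕ) : ⁅Dd n, Ud n⁆ = Hd n := by
  apply derivation_ext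
  intro i
  rw [Derivation.commutator_apply]
  simp only [Dd, Ud, Hd, mkDerivation_X, Derivation.map_smul, smul_smul, add_sub_cancel_right,
    sub_add_cancel, ← sub_smul]
  congr 1
  have hi := i.2
  by_cases h0 : (i : ℕ) = 0
  · by_cases hn : (i : ℕ) = n
    · have hn' : (n : ℚ) = 0 := by exact_mod_cast (hn.symm.trans h0)
      rw [h0, hn']; simp
    · rw [fin_add_one_val i hn]; push_cast; rw [h0]; simp
  · have h1 := fin_sub_one_val i h0
    have h1' : (((i - 1 : Fin (n + 1)) : ℕ) : ℚ) = (i : ℕ) - 1 := by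
      rw [← h1]; push_cast; ring
    rw [h1']
    by_cases hn : (i : ℕ) = n
    · rw [hn]; ring
    · rw [fin_add_one_val i hn]; push_cast; ring

lemma Wsp_eq_span (n m r : ℕ) : Wsp n m r =
    Submodule.span ℚ ((fun e => monomial e (1 : ℚ)) '' {e | Finsupp.weight (wt n) e = (m, r)}) := by
  rw [Wsp, weightedHomogeneousSubmodule_eq_finsupp_supported, ← restrictSupport_eq_span]
  rfl

/-- derivations shifting the variables shift the weights -/
lemma deriv_mem (n : ℕ) (c : Fin (n + 1) → ℚ) (τ : Fin (n + 1) → Fin (n + 1)) (m r r' a b : ℕ)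
    (hτ : ∀ i, c i ≠ 0 → (τ i : ℕ) + a = i + b) (hr : r + b = r' + a)
    (v : MvPolynomial (Fin (n + 1)) ℚ) (hv : v ∈ Wsp n m r) :
    mkDerivation ℚ (fun i => c i • (X (τ i) : MvPolynomial (Fin (n + 1)) ℚ)) v ∈ Wsp n m r' := by
  rw [Wsp_eq_span] at hv
  induction hv using Submodule.span_induction with
  | zero => simp
  | add x y _ _ hx hy => rw [map_add]; exact Submodule.add_mem _ hx hy
  | smul a x _ hx => rw [Derivation.map_smul]; exact Submodule.smul_mem _ _ hx
  | mem x hx =>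
    obtain ⟨e, he, rfl⟩ := hx
    simp only [Set.mem_ofPred_eq] at he
    simp only [mkDerivation_monomial, one_smul]
    refine Submodule.sum_mem _ fun i hi => ?_
    have hi' : e i ≠ 0 := Finsupp.mem_support_iff.1 hi
    by_cases hc : c i = 0
    · simp [hc]
    simp only [smul_eq_mul, mul_smul_comm]
    refine Submodule.smul_mem _ _ ?_
    have hw := Finsupp.weight_sub_single_add (w := wt n) hi'
    rw [he] at hw
    have h1 : IsWeightedHomogeneous (wt n) (monomial (e - Finsupp.single i 1) ((e i : ℕ) : ℚ))
        (Finsupp.weight (wt n) (e - Finsupp.single i 1)) :=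
      isWeightedHomogeneous_monomial _ _ _ rfl
    have h2 := h1.mul (isWeightedHomogeneous_X ℚ (wt n) (τ i))
    have h3 : Finsupp.weight (wt n) (e - Finsupp.single i 1) + wt n (τ i) = (m, r') := by
      have := hτ i hc
      have p1 := congrArg Prod.fst hw
      have p2 := congrArg Prod.snd hw
      simp only [Prod.fst_add, Prod.snd_add, wt] at p1 p2
      ext
      · simp only [Prod.fst_add, wt]; omega
      · simp only [Prod.snd_add, wt]; omega
    rw [h3] at h2
    exact h2

lemma D_mem (n m r : ℕ) (v) (hv : v ∈ Wsp n m (r + 1)) : Dd n v ∈ Wsp n m r := by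
  refine deriv_mem n _ _ m (r + 1) r 1 0 ?_ rfl v hv
  intro i hi
  exact fin_sub_one_val i (by exact_mod_cast hi)

lemma U_mem (n m r : ℕ) (v) (hv : v ∈ Wsp n m r) : Ud n v ∈ Wsp n m (r + 1) := by
  refine deriv_mem n _ _ m r (r + 1) 0 1 ?_ rfl v hv
  intro i hi
  rw [fin_add_one_val i (fun h => hi (by rw [h]; simp)), Nat.add_zero]

lemma H_apply (n m r : ℕ) (v) (hv : v ∈ Wsp n m r) :
    Hd n v = (((m * n : ℕ) : ℚ) - 2 * r) • v := by
  rw [Wsp_eq_span] at hv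
  induction hv using Submodule.span_induction with
  | zero => simp
  | add x y _ _ hx hy => rw [map_add, hx, hy, smul_add]
  | smul a x _ hx => rw [Derivation.map_smul, hx, smul_comm]
  | mem x hx =>
    obtain ⟨e, he, rfl⟩ := hx
    simp only [Set.mem_ofPred_eq] at he
    simp only [Hd, mkDerivation_monomial, one_smul]
    have h1 : ∀ i ∈ e.support, (monomial (e - Finsupp.single i 1) ((e i : ℕ) : ℚ)) •
        (((n : ℚ) - 2 * (i : ℕ)) • (X i : MvPolynomial (Fin (n + 1)) ℚ)) =
        ((e i : ℚ) * ((n : ℚ) - 2 * (i : ℕ))) • monomial e (1 : ℚ) := by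
      intro i hi
      have hi' : e i ≠ 0 := Finsupp.mem_support_iff.1 hi
      rw [smul_eq_mul, mul_smul_comm, X, monomial_mul, smul_monomial, smul_monomial]
      have : e - Finsupp.single i 1 + Finsupp.single i 1 = e :=
        tsub_add_cancel_of_le (Finsupp.single_le_iff.2 (by omega))
      rw [this]
      simp [mul_comm]
    rw [Finsupp.sum, Finset.sum_congr rfl h1, ← Finset.sum_smul]
    congr 1
    rw [Finsupp.weight_apply, Finsupp.sum] at he
    have p1 := congrArg Prod.fst he
    have p2 := congrArg Prod.snd he
    simp only [Prod.fst_sum, Prod.snd_sum, wt, Prod.smul_mk, smul_eq_mul, mul_one] at p1 p2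
    rw [← p1, ← p2]
    push_cast
    rw [Finset.sum_mul, Finset.mul_sum, ← Finset.sum_sub_distrib]
    refine Finset.sum_congr rfl fun i _ => ?_
    ring

lemma D_zero (n m : ℕ) (v) (hv : v ∈ Wsp n m 0) : Dd n v = 0 := by
  rw [Wsp_eq_span] at hv
  induction hv using Submodule.span_induction with
  | zero => simp
  | add x y _ _ hx hy => rw [map_add, hx, hy, add_zero]
  | smul a x _ hx => rw [Derivation.map_smul, hx, smul_zero]
  | mem x hx =>
    obtain ⟨e, he, rfl⟩ := hx
    simp only [Set.mem_ofPred_eq] at he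
    simp only [Dd, mkDerivation_monomial, one_smul]
    refine Finset.sum_eq_zero fun i hi => ?_
    have hi' : e i ≠ 0 := Finsupp.mem_support_iff.1 hi
    have hw := Finsupp.weight_sub_single_add (w := wt n) hi'
    rw [he] at hw
    have p2 := congrArg Prod.snd hw
    simp only [Prod.snd_add, wt] at p2
    have : (i : ℕ) = 0 := by omega
    simp [this]

/-- multiset of a monomial -/
noncomputable def expMS (n : ℕ) (e : Fin (n + 1) →₀ ℕ) : Multiset ℕ :=
  (Finsupp.toMultiset e).map Fin.val

lemma expMS_inj (n : ℕ) : Function.Injective (expMS n) := by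
  intro e f h
  have h1 := congrArg Multiset.toFinsupp (Multiset.map_injective Fin.val_injective h)
  simpa using h1

lemma weight_toMultiset (n : ℕ) (s : Multiset (Fin (n + 1))) :
    Finsupp.weight (wt n) (Multiset.toFinsupp s) =
      (Multiset.card s, (s.map Fin.val).sum) := by
  induction s using Multiset.induction_on with
  | empty => simp; rfl
  | cons a s ih =>
    rw [← Multiset.singleton_add, map_add, map_add, ih, Multiset.toFinsupp_singleton,
      Finsupp.weight_single]
    simp [wt, add_comm]

lemma expMS_image (n m r : ℕ) :
    expMS n '' {e | Finsupp.weight (wt n) e = (m, r)} = MS m n r := by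
  ext s
  constructor
  · rintro ⟨e, he, rfl⟩
    simp only [Set.mem_ofPred_eq] at he
    have h := weight_toMultiset n (Finsupp.toMultiset e)
    rw [Finsupp.toMultiset_toFinsupp, he, Prod.mk.injEq] at h
    refine ⟨by simp [expMS, ← h.1], ?_, h.2.symm⟩
    intro x hx
    obtain ⟨y, -, rfl⟩ := Multiset.mem_map.1 hx
    exact Nat.le_of_lt_succ y.2
  · rintro ⟨h1, h2, h3⟩
    have hs : ((s.map fun x => (Fin.ofNat (n + 1) x)).map Fin.val) = s := by
      rw [Multiset.map_map]
      conv_rhs => rw [← Multiset.map_id s]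
      refine Multiset.map_congr rfl fun x hx => ?_
      have := h2 x hx
      simp only [Function.comp, Fin.val_ofNat, id]
      exact Nat.mod_eq_of_lt (by omega)
    refine ⟨Multiset.toFinsupp (s.map fun x => (Fin.ofNat (n + 1) x)), ?_, ?_⟩
    · simp only [Set.mem_ofPred_eq]
      rw [weight_toMultiset, hs, h3]
      simp [h1]
    · rw [expMS, Multiset.toFinsupp_toMultiset, hs]

lemma exp_finite (n m r : ℕ) : Finite {e : Fin (n + 1) →₀ ℕ | Finsupp.weight (wt n) e = (m, r)} := by
  apply Set.Finite.of_finite_image _ (expMS_inj n).injOn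
  rw [expMS_image]
  exact MS_finite _ _ _

lemma Wsp_eq_restrict (n m r : ℕ) :
    Wsp n m r = restrictSupport ℚ {e | Finsupp.weight (wt n) e = (m, r)} :=
  weightedHomogeneousSubmodule_eq_finsupp_supported _ _ _

instance Wsp_fd (n m r : ℕ) : FiniteDimensional ℚ (Wsp n m r) := by
  rw [Wsp_eq_restrict]
  have := exp_finite n m r
  exact Module.Finite.of_basis (basisRestrictSupport ℚ _)

lemma Wsp_finrank (n m r : ℕ) : Module.finrank ℚ (Wsp n m r) = gaussP m n r := by
  rw [Wsp_eq_restrict, Module.finrank_eq_nat_card_basis (basisRestrictSupport ℚ _), gaussP_eq,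
    ← expMS_image, Set.ncard_image_of_injective _ (expMS_inj n), Nat.card_coe_set_eq]

/-- highest weight vectors -/
noncomputable def Ksp (n m r : ℕ) : Submodule ℚ (MvPolynomial (Fin (n + 1)) ℚ) :=
  Wsp n m r ⊓ LinearMap.ker (Dd n : MvPolynomial (Fin (n + 1)) ℚ →ₗ[ℚ] MvPolynomial (Fin (n + 1)) ℚ)

instance Ksp_fd (n m r : ℕ) : FiniteDimensional ℚ (Ksp n m r) := by
  unfold Ksp; infer_instance

/-- multiplicities -/
noncomputable def gm (m n r : ℕ) : ℕ := Module.finrank ℚ (Ksp n m r)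

lemma gm_succ (m n r : ℕ) (h : 2 * r < m * n) :
    gaussP m n r + gm m n (r + 1) = gaussP m n (r + 1) := by
  rw [← Wsp_finrank, ← Wsp_finrank]
  refine sl2_finrank (Dd n : MvPolynomial (Fin (n + 1)) ℚ →ₗ[ℚ] _)
    (Ud n : MvPolynomial (Fin (n + 1)) ℚ →ₗ[ℚ] _) (Wsp n m) (m * n) (D_mem n m) (D_zero n m)
    (U_mem n m) ?_ r h
  intro r v hv
  rw [← H_apply n m r v hv, ← comm_DU, Derivation.commutator_apply]
  rfl

lemma gaussP_zero (m n : ℕ) : gaussP m n 0 = 1 := by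
  rw [gaussP_eq, Set.ncard_eq_one]
  refine ⟨Multiset.replicate m 0, ?_⟩
  ext s
  constructor
  · rintro ⟨h1, h2, h3⟩
    refine Multiset.eq_replicate.2 ⟨h1, fun b hb => ?_⟩
    exact Multiset.sum_eq_zero_iff.1 h3 b hb
  · rintro rfl
    refine ⟨by simp, ?_, by simp⟩
    intro x hx
    rw [Multiset.eq_of_mem_replicate hx]
    exact Nat.zero_le _

lemma gm_zero (m n : ℕ) : gm m n 0 = 1 := by
  rw [← gaussP_zero m n, ← Wsp_finrank, gm]
  have : Ksp n m 0 = Wsp n m 0 := by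
    refine inf_eq_left.2 fun v hv => ?_
    exact D_zero n m v hv
  rw [this]

lemma gm_add (m m' n r r' : ℕ) (h : 0 < gm m n r) (h' : 0 < gm m' n r') :
    gm m n r + gm m' n r' ≤ gm (m + m') n (r + r') + 1 := by
  refine finrank_mul MonomialOrder.lex _ _ _ ?_ h h'
  rintro a ⟨ha, ha'⟩ b ⟨hb, hb'⟩
  refine ⟨IsWeightedHomogeneous.mul ha hb, ?_⟩
  have e1 : Dd n a = 0 := ha'
  have e2 : Dd n b = 0 := hb'
  change Dd n (a * b) = 0
  rw [Derivation.leibniz, e1, e2]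
  simp

lemma gm_symm (m n r : ℕ) (h : 2 * r ≤ m * n) : gm m n r = gm n m r := by
  rcases r with _ | r
  · rw [gm_zero, gm_zero]
  · have h1 := gm_succ m n r (by omega)
    have h2 := gm_succ n m r (by rw [mul_comm n m]; omega)
    rw [gaussP_symm n m, gaussP_symm n m] at h2
    omega
end poly


section table

/-- addition of coefficient lists -/
def padd : List ℕ → List ℕ → List ℕ
  | [], b => b
  | x :: a, [] => x :: a
  | x :: a, y :: b => (x + y) :: padd a b

lemma padd_getD (a b : List ℕ) (r : ℕ) : (padd a b).getD r 0 = a.getD r 0 + b.getD r 0 := by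
  induction a generalizing b r with
  | nil => simp [padd]
  | cons x a ih =>
    cases b with
    | nil => simp [padd]
    | cons y b =>
      cases r with
      | zero => simp [padd]
      | succ r => simpa [padd] using ih b r

/-- one row of Gaussian coefficients from the previous one -/
def nxt : ℕ → List ℕ → List (List ℕ) → List (List ℕ)
  | _, _, [] => []
  | n, cur, q :: qs =>
    padd cur (List.replicate (n + 1) 0 ++ q) ::
      nxt (n + 1) (padd cur (List.replicate (n + 1) 0 ++ q)) qs

/-- coefficient lists for `n = 1, …, 15` -/
def rows : ℕ → List (List ℕ)
  | 0 => List.replicate 15 [1]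
  | m + 1 => nxt 0 [1] (rows m)

/-- `l` lists the coefficients -/
def GoodL (m n : ℕ) (l : List ℕ) : Prop := ∀ r, l.getD r 0 = gaussP m n r

lemma good_one_left (n : ℕ) : GoodL 0 n [1] := by
  intro r
  rw [gaussP_eq, MS_zero_left]
  cases r <;> simp

lemma good_one_right (m : ℕ) : GoodL m 0 [1] := by
  intro r
  rw [gaussP_eq, MS_zero_right]
  cases r <;> simp

lemma good_step (m n : ℕ) (a b : List ℕ) (ha : GoodL (m + 1) n a) (hb : GoodL m (n + 1) b) :
    GoodL (m + 1) (n + 1) (padd a (List.replicate (n + 1) 0 ++ b)) := by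
  intro r
  rw [padd_getD, ha r, gaussP_eq, gaussP_eq, MS_rec1]
  congr 1
  split_ifs with h
  · rw [List.getD_append_right _ _ _ _ (by simpa using h), hb, gaussP_eq]
    simp
  · rw [List.getD_append _ _ _ _ (by simpa using h)]
    rw [List.getD_replicate _ (by omega)]

lemma nxt_good (m n : ℕ) (cur : List ℕ) (L : List (List ℕ)) (hc : GoodL (m + 1) n cur)
    (hL : ∀ i (h : i < L.length), GoodL m (n + 1 + i) L[i]) :
    ∀ i (h : i < (nxt n cur L).length), GoodL (m + 1) (n + 1 + i) (nxt n cur L)[i] := by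
  induction L generalizing n cur with
  | nil => intro i h; simp [nxt] at h
  | cons q qs ih =>
    have h0 := good_step m n cur q hc (hL 0 (by simp))
    intro i h
    cases i with
    | zero => exact h0
    | succ i =>
      have := ih (n + 1) _ h0 (fun j hj => by
        have := hL (j + 1) (by simpa using hj)
        rw [show n + 1 + 1 + j = n + 1 + (j + 1) by omega]
        exact this) i (by simpa [nxt] using h)
      rw [show n + 1 + (i + 1) = n + 1 + 1 + i by omega]
      exact this

lemma rows_good (m : ℕ) : ∀ i (h : i < (rows m).length), GoodL m (i + 1) (rows m)[i] := by
  induction m with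
  | zero =>
    intro i h
    simp only [rows, List.getElem_replicate]
    exact good_one_left _
  | succ m ih =>
    intro i h
    have := nxt_good m 0 [1] (rows m) (good_one_right _) (fun j hj => by
      rw [show 0 + 1 + j = j + 1 by omega]; exact ih j hj) i h
    rw [show i + 1 = 0 + 1 + i by omega]
    exact this

lemma nxt_length (n : ℕ) (cur : List ℕ) (L : List (List ℕ)) : (nxt n cur L).length = L.length := by
  induction L generalizing n cur with
  | nil => rfl
  | cons q qs ih => simp [nxt, ih]

lemma rows_length (m : ℕ) : (rows m).length = 15 := by
  induction m with
  | zero => simp [rows]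
  | succ m ih => rw [rows, nxt_length, ih]

/-- consecutive differences at least `d` -/
def scan (d : ℕ) : ℕ → List ℕ → Bool
  | 0, _ => true
  | k + 1, x :: y :: t => Nat.ble (x + d) y && scan d k (y :: t)
  | _ + 1, _ => false

lemma scan_spec (d k : ℕ) (l : List ℕ) (h : scan d k l = true) (i : ℕ) (hi : i < k) :
    l.getD i 0 + d ≤ l.getD (i + 1) 0 := by
  induction k generalizing l i with
  | zero => omega
  | succ k ih =>
    match l, h with
    | x :: y :: t, h =>
      simp only [scan, Bool.and_eq_true] at h
      cases i with
      | zero => simpa using Nat.le_of_ble_eq_true h.1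
      | succ i => simpa using ih (y :: t) h.2 i (by omega)

lemma scan_rows (d s k m n : ℕ) (hn : 1 ≤ n) (hn' : n ≤ 15)
    (h : scan d k (((rows m).getD (n - 1) []).drop s) = true) (r : ℕ) (h1 : s ≤ r)
    (h2 : r < s + k) : gaussP m n r + d ≤ gaussP m n (r + 1) := by
  have hg := rows_good m (n - 1) (by rw [rows_length]; omega)
  rw [Nat.sub_add_cancel hn] at hg
  rw [List.getD_eq_getElem _ _ (by rw [rows_length]; omega)] at h
  have h3 := scan_spec d k _ h (r - s) (by omega)
  have hdrop : ∀ (l : List ℕ) i, (l.drop s).getD i 0 = l.getD (s + i) 0 := by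
    intro l i; simp [List.getD_eq_getElem?_getD]
  rw [hdrop, hdrop, hg, hg] at h3
  rwa [show s + (r - s) = r by omega, show s + (r - s + 1) = r + 1 by omega] at h3

lemma table1 : ((List.range' 8 8).all fun m => (List.range' 8 8).all fun n =>
    scan 1 (m * n / 2 - 1) (((rows m).getD (n - 1) []).drop 1)) = true := by
  decide +kernel

lemma table2 : ((List.range' 8 8).all fun n =>
    scan 2 (4 * n - 3) (((rows 8).getD (n - 1) []).drop 3)) = true := by
  decide +kernel

lemma table3 : scan 4 1 (((rows 8).getD 7 []).drop 5) = true := by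
  decide +kernel

lemma table4 : scan 3 2 (((rows 8).getD 7 []).drop 5) = true := by
  decide +kernel

end table


section final

lemma le_gm_of (d m n r : ℕ) (h : 2 * (r + 1) ≤ m * n)
    (h' : gaussP m n r + d ≤ gaussP m n (r + 1)) : d ≤ gm m n (r + 1) := by
  have := gm_succ m n r (by omega)
  omega

/-- strict unimodality -/
def Tp (m n : ℕ) : Prop := ∀ r, r ≠ 1 → 2 * r ≤ m * n → 1 ≤ gm m n r

lemma Tp_symm {m n : ℕ} (h : Tp m n) : Tp n m := by
  intro r h1 h2
  rw [gm_symm n m r h2]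
  exact h r h1 (by rwa [mul_comm m n])

lemma Tp_base (m n : ℕ) (hm : 8 ≤ m) (hm' : m < 16) (hn : 8 ≤ n) (hn' : n < 16) : Tp m n := by
  intro r h1 h2
  rcases r with _ | r
  · rw [gm_zero]
  · have ht := table1
    rw [List.all_eq_true] at ht
    have ht1 := ht m (by simp; omega)
    rw [List.all_eq_true] at ht1
    have ht2 := ht1 n (by simp; omega)
    exact le_gm_of 1 m n r h2
      (scan_rows 1 1 _ m n (by omega) (by omega) ht2 r (by omega) (by omega))

lemma Tp_add {m n : ℕ} (hm : 8 ≤ m) (hn : 8 ≤ n) (h : Tp m n) (h8 : Tp 8 n) : Tp (m + 8) n := by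
  intro r h1 h2
  have hmn : 8 * 8 ≤ m * n := Nat.mul_le_mul hm hn
  have h2' : 2 * r ≤ m * n + 8 * n := by rw [← add_mul]; exact h2
  have key : ∀ a b, a + b = r → a ≠ 1 → b ≠ 1 → 2 * a ≤ m * n → 2 * b ≤ 8 * n →
      1 ≤ gm (m + 8) n r := by
    intro a b hab ha hb ha' hb'
    have e1 := h a ha ha'
    have e2 := h8 b hb hb'
    have := gm_add m 8 n a b e1 e2
    rw [hab] at this
    omega
  generalize m * n = P at *
  by_cases c1 : 2 * r ≤ P
  · exact key r 0 (by omega) h1 (by omega) c1 (by omega)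
  · by_cases c2 : r = P / 2 + 1
    · exact key (P / 2 - 1) 2 (by omega) (by omega) (by omega) (by omega) (by omega)
    · exact key (P / 2) (r - P / 2) (by omega) (by omega) (by omega) (by omega) (by omega)

lemma Tp_all_left (n : ℕ) (hn : 8 ≤ n) (hb : ∀ m, 8 ≤ m → m < 16 → Tp m n) (m : ℕ) (hm : 8 ≤ m) :
    Tp m n := by
  induction m using Nat.strong_induction_on with
  | _ m ih =>
    by_cases h : m < 16
    · exact hb m hm h
    · have := Tp_add (m := m - 8) (by omega) hn (ih (m - 8) (by omega) (by omega))
        (hb 8 le_rfl (by omega))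
      rwa [Nat.sub_add_cancel hm] at this

lemma Tp_all (m n : ℕ) (hm : 8 ≤ m) (hn : 8 ≤ n) : Tp m n := by
  refine Tp_all_left n hn (fun m hm hm' => ?_) m hm
  refine Tp_symm (Tp_all_left m hm (fun k hk hk' => Tp_base k m hk hk' hm hm') n hn)

lemma gm_mono_left (m k n r d : ℕ) (h : d ≤ gm m n r) : d ≤ gm (m + k) n r := by
  rcases Nat.eq_zero_or_pos d with rfl | hd
  · exact Nat.zero_le _
  · have := gm_add m k n r 0 (by omega) (by rw [gm_zero]; omega)
    rw [gm_zero] at this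
    simp only [Nat.add_zero] at this
    omega

lemma gm_mono (m n m' n' r d : ℕ) (hm : m ≤ m') (hn : n ≤ n') (hr : 2 * r ≤ m * n)
    (h : d ≤ gm m n r) : d ≤ gm m' n' r := by
  obtain ⟨k, rfl⟩ := Nat.exists_eq_add_of_le hm
  obtain ⟨l, rfl⟩ := Nat.exists_eq_add_of_le hn
  apply gm_mono_left
  have hr' : 2 * r ≤ m * (n + l) := hr.trans (Nat.mul_le_mul_left m hn)
  rw [gm_symm _ _ _ hr']
  apply gm_mono_left
  rwa [gm_symm _ _ _ (by rwa [mul_comm n m])]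

lemma two_le (n : ℕ) (hn : 8 ≤ n) (r : ℕ) (h1 : 4 ≤ r) (h2 : r ≤ 4 * n) : 2 ≤ gm 8 n r := by
  induction n using Nat.strong_induction_on generalizing r with
  | _ n ih =>
    by_cases h : n < 16
    · obtain ⟨r, rfl⟩ := Nat.exists_eq_add_of_le' (show 1 ≤ r by omega)
      have ht := table2
      rw [List.all_eq_true] at ht
      have ht1 := ht n (by simp; omega)
      exact le_gm_of 2 8 n r (by omega)
        (scan_rows 2 3 _ 8 n (by omega) (by omega) ht1 r (by omega) (by omega))
    · have key : ∀ a b, a + b = r → 4 ≤ a → b ≠ 1 → a ≤ 4 * (n - 8) → b ≤ 32 → 2 ≤ gm 8 n r := by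
        intro a b hab ha hb ha' hb'
        have e1 := ih (n - 8) (by omega) (by omega) a ha ha'
        have e2 := Tp_all 8 8 le_rfl le_rfl b hb (by omega)
        rw [gm_symm _ _ _ (by omega)] at e1
        have := gm_add (n - 8) 8 8 a b (by omega) e2
        rw [hab, Nat.sub_add_cancel hn] at this
        rw [gm_symm _ _ _ (by omega)]
        omega
      by_cases c1 : r ≤ 4 * (n - 8)
      · exact key r 0 (by omega) (by omega) (by omega) (by omega) (by omega)
      · by_cases c2 : r = 4 * (n - 8) + 1
        · exact key (r - 2) 2 (by omega) (by omega) (by omega) (by omega) (by omega)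
        · exact key (4 * (n - 8)) (r - 4 * (n - 8)) (by omega) (by omega) (by omega) (by omega)
            (by omega)

lemma four_le (m n : ℕ) (hm : 8 ≤ m) (hn : 8 ≤ n) : 4 ≤ gm m n 6 := by
  refine gm_mono 8 8 m n 6 4 hm hn (by omega) ?_
  exact le_gm_of 4 8 8 5 (by omega)
    (scan_rows 4 5 1 8 8 (by omega) (by omega) table3 5 (by omega) (by omega))

lemma three_le (m n : ℕ) (hm : 8 ≤ m) (hn : 8 ≤ n) : 3 ≤ gm m n 7 := by
  refine gm_mono 8 8 m n 7 3 hm hn (by omega) ?_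
  exact le_gm_of 3 8 8 6 (by omega)
    (scan_rows 3 5 2 8 8 (by omega) (by omega) table4 6 (by omega) (by omega))

lemma main_bound (d m n r : ℕ) (hd : 0 < d) (hm : 8 * d ≤ m) (hn : 8 * d ≤ n)
    (hr1 : 2 * d ≤ r) (hr2 : 2 * r ≤ m * n) : d ≤ gm m n r := by
  induction d using Nat.strong_induction_on generalizing m r with
  | _ d ih =>
    by_cases d1 : d = 1
    · subst d1
      exact Tp_all m n (by omega) (by omega) r (by omega) hr2
    by_cases hr : 2 * d + 2 ≤ r
    · obtain ⟨k, rfl⟩ := Nat.exists_eq_add_of_le' (show 8 ≤ m by omega)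
      have hkn : (8 * (d - 1)) * (8 * d) ≤ k * n := Nat.mul_le_mul (by omega) hn
      have hkn' : (8 * (d - 1)) * 8 ≤ (8 * (d - 1)) * (8 * d) := Nat.mul_le_mul_left _ (by omega)
      rw [add_mul] at hr2
      have key : ∀ a b, a + b = r → 2 * (d - 1) ≤ a → 2 * a ≤ k * n → 4 ≤ b → b ≤ 4 * n →
          d ≤ gm (k + 8) n r := by
        intro a b hab ha ha' hb hb'
        have e1 := ih (d - 1) (by omega) k a (by omega) (by omega) (by omega) ha ha'
        have e2 := two_le n (by omega) b hb hb'
        have := gm_add k 8 n a b (by omega) (by omega)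
        rw [hab] at this
        omega
      generalize k * n = P at *
      by_cases c : 2 * (r - 4) ≤ P
      · exact key (r - 4) 4 (by omega) (by omega) c (by omega) (by omega)
      · exact key (P / 2) (r - P / 2) (by omega) (by omega) (by omega) (by omega) (by omega)
    · by_cases d3 : d ≤ 3
      · have h23 : d = 2 ∨ d = 3 := by omega
        rcases h23 with rfl | rfl
        · refine gm_mono 8 n m n r 2 (by omega) le_rfl (by omega) ?_
          exact two_le n (by omega) r (by omega) (by omega)
        · have h67 : r = 6 ∨ r = 7 := by omega
          rcases h67 with rfl | rfl
          · exact (four_le m n (by omega) (by omega)).trans' (by omega)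
          · exact three_le m n (by omega) (by omega)
      · obtain ⟨k, rfl⟩ := Nat.exists_eq_add_of_le' (show 24 ≤ m by omega)
        have hkn : 8 * (8 * d) ≤ k * n := Nat.mul_le_mul (by omega) hn
        have e1 := ih (d - 3) (by omega) k (r - 6) (by omega) (by omega) (by omega) (by omega)
          (by omega)
        have e2 := four_le 24 n (by omega) (by omega)
        have := gm_add k 24 n (r - 6) 6 (by omega) (by omega)
        rw [Nat.sub_add_cancel (by omega)] at this
        omega

end final

theorem stmt0 (d m n r : ℕ) (hd : 0 < d) (hm : 8 * d ≤ m) (hn : 8 * d ≤ n)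
    (hr1 : 2 * d ≤ r) (hr2 : 2 * r ≤ m * n) :
    gaussP m n (r - 1) + d ≤ gaussP m n r := by
  have h := main_bound d m n r hd hm hn hr1 hr2
  obtain ⟨r, rfl⟩ := Nat.exists_eq_add_of_le' (show 1 ≤ r by omega)
  have := gm_succ m n r (by omega)
  rw [Nat.add_sub_cancel]
  omega
end

section
/- Let d, m, n, r be positive integers with d ≥ 1, m ≥ 8d, n ≥ 2d + 1, 2d ≤ r, and 2r ≤ m(n − 2d). Then p_r(m,n) − p_{r−1}(m,n) ≥ d. -/
open MvPolynomial

namespace GP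

/-- Exponent vectors in the variables `x_0, …, x_N`, of degree `M` and weight `r`. -/
def monSet (N M r : ℕ) : Set (ℕ →₀ ℕ) :=
  {s | (∀ i ∈ s.support, i ≤ N) ∧ s.degree = M ∧ Finsupp.weight (fun i : ℕ => i) s = r}

/-- Bihomogeneous polynomials in `x_0, …, x_N`, of degree `M` and weight `r`. -/
noncomputable def V (N M r : ℕ) : Submodule ℚ (MvPolynomial ℕ ℚ) :=
  restrictSupport ℚ (monSet N M r)

lemma monomial_mem {N M r : ℕ} {s : ℕ →₀ ℕ} (hs : s ∈ monSet N M r) (c : ℚ) :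
    monomial s c ∈ V N M r := by
  unfold V
  rw [monomial_mem_restrictSupport]
  exact Or.inl hs

lemma V_induction {N M r : ℕ} {W : Submodule ℚ (MvPolynomial ℕ ℚ)}
    (h : ∀ s ∈ monSet N M r, monomial s (1 : ℚ) ∈ W) : V N M r ≤ W := by
  unfold V
  rw [restrictSupport_eq_span, Submodule.span_le]
  rintro _ ⟨s, hs, rfl⟩
  exact h s hs

lemma mul_mem {N M r M' r' : ℕ} {p q : MvPolynomial ℕ ℚ} (hp : p ∈ V N M r)
    (hq : q ∈ V N M' r') : p * q ∈ V N (M + M') (r + r') := by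
  have h := Submodule.mul_mem_mul hp hq
  unfold V at h
  rw [← restrictSupport_add] at h
  refine restrictSupport_mono (R := ℚ) ?_ h
  rintro _ ⟨s, ⟨hs1, hs2, hs3⟩, t, ⟨ht1, ht2, ht3⟩, rfl⟩
  refine ⟨?_, ?_, ?_⟩
  · intro i hi
    have := Finsupp.support_add hi
    rcases Finset.mem_union.1 this with h | h
    · exact hs1 i h
    · exact ht1 i h
  · simp [hs2, ht2]
  · simp [hs3, ht3]

lemma X_mem {N i : ℕ} (hi : i ≤ N) : (X i : MvPolynomial ℕ ℚ) ∈ V N 1 i := by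
  apply monomial_mem
  refine ⟨?_, ?_, ?_⟩
  · intro j hj
    have := Finsupp.support_single_subset hj
    simp at this
    omega
  · simp
  · simp [Finsupp.weight_single]

lemma one_mem {N : ℕ} : (1 : MvPolynomial ℕ ℚ) ∈ V N 0 0 := by
  apply monomial_mem
  refine ⟨?_, ?_, ?_⟩ <;> simp

/-- Removing a variable. -/
lemma sub_mem {N M r : ℕ} {s : ℕ →₀ ℕ} (hs : s ∈ monSet N M r) {i : ℕ} (hi : i ∈ s.support) :
    ∃ M' r', M = M' + 1 ∧ r = r' + i ∧ s - Finsupp.single i 1 ∈ monSet N M' r' := by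
  obtain ⟨h1, h2, h3⟩ := hs
  have hi0 : s i ≠ 0 := by simpa using hi
  have hsub := Finsupp.sub_add_single_one_cancel hi0
  refine ⟨(s - Finsupp.single i 1).degree, Finsupp.weight (fun i : ℕ => i) (s - Finsupp.single i 1),
    ?_, ?_, ?_, rfl, rfl⟩
  · rw [← h2]
    conv_lhs => rw [← hsub]
    simp
  · rw [← h3]
    conv_lhs => rw [← hsub]
    simp [Finsupp.weight_single]
  · intro j hj
    apply h1
    exact Finsupp.support_tsub hj

/-- The lowering derivation. -/
noncomputable def D : Derivation ℚ (MvPolynomial ℕ ℚ) (MvPolynomial ℕ ℚ) :=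
  mkDerivation ℚ fun i => if i = 0 then 0 else X (i - 1)

/-- The raising derivation. -/
noncomputable def F (N : ℕ) : Derivation ℚ (MvPolynomial ℕ ℚ) (MvPolynomial ℕ ℚ) :=
  mkDerivation ℚ fun i => (((i : ℚ) + 1) * ((N : ℚ) - i)) • X (i + 1)

/-- The diagonal derivation. -/
noncomputable def H (N : ℕ) : Derivation ℚ (MvPolynomial ℕ ℚ) (MvPolynomial ℕ ℚ) :=
  mkDerivation ℚ fun i => ((N : ℚ) - 2 * i) • X i

@[simp] lemma D_X_zero : D (X 0) = 0 := by simp [D]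
@[simp] lemma D_X_succ (i : ℕ) : D (X (i + 1)) = X i := by simp [D]
@[simp] lemma F_X (N i : ℕ) :
    F N (X i) = (((i : ℚ) + 1) * ((N : ℚ) - i)) • X (i + 1) := by simp [F]
@[simp] lemma H_X (N i : ℕ) : H N (X i) = ((N : ℚ) - 2 * i) • X i := by simp [H]

lemma comm_apply (N : ℕ) (p : MvPolynomial ℕ ℚ) : D (F N p) = F N (D p) + H N p := by
  have : ⁅D, F N⁆ = H N := by
    apply derivation_ext
    intro i
    rw [Derivation.commutator_apply]
    cases i with
    | zero => simp
    | succ i =>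
      simp only [F_X, H_X, D_X_succ, Derivation.map_smul, ← sub_smul]
      congr 1
      push_cast
      ring
  rw [← this, Derivation.commutator_apply]
  ring

lemma H_apply {N M r : ℕ} {p : MvPolynomial ℕ ℚ} (hp : p ∈ V N M r) :
    H N p = ((N : ℚ) * M - 2 * r) • p := by
  have : V N M r ≤ LinearMap.ker ((H N).toLinearMap - ((N : ℚ) * M - 2 * r) • LinearMap.id) := by
    apply V_induction
    rintro s ⟨h1, h2, h3⟩
    rw [LinearMap.mem_ker]
    change H N (monomial s 1) - ((N : ℚ) * M - 2 * r) • monomial s 1 = 0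
    rw [sub_eq_zero]
    rw [H, mkDerivation_monomial, one_smul]
    have : ∀ i ∈ s.support, (monomial (s - Finsupp.single i 1) ((s i : ℕ) : ℚ)) •
        ((N : ℚ) - 2 * i) • (X i : MvPolynomial ℕ ℚ) = monomial s ((s i : ℚ) * (N - 2 * i)) := by
      intro i hi
      have hi0 : s i ≠ 0 := by simpa using hi
      rw [smul_eq_mul, mul_smul_comm, X, monomial_mul, Finsupp.sub_add_single_one_cancel hi0,
        smul_monomial]
      congr 1
      simp [mul_comm]
    rw [Finsupp.sum, Finset.sum_congr rfl this, smul_monomial, ← map_sum]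
    congr 1
    rw [← h2, ← h3, Finsupp.degree_apply, Finsupp.weight_apply, Finsupp.sum]
    push_cast
    simp only [Finset.mul_sum, smul_eq_mul, ← Finset.sum_sub_distrib, mul_one]
    refine Finset.sum_congr rfl fun i _ => ?_
    push_cast
    ring
  have h := this hp
  rw [LinearMap.mem_ker] at h
  change H N p - ((N : ℚ) * M - 2 * r) • p = 0 at h
  exact sub_eq_zero.1 h

lemma F_mem {N M r : ℕ} {p : MvPolynomial ℕ ℚ} (hp : p ∈ V N M r) :
    F N p ∈ V N M (r + 1) := by
  have : V N M r ≤ (V N M (r + 1)).comap (F N).toLinearMap := by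
    apply V_induction
    intro s hs
    change F N (monomial s 1) ∈ V N M (r + 1)
    rw [F, mkDerivation_monomial, one_smul]
    refine Submodule.sum_mem _ fun i hi => ?_
    obtain ⟨M', r', rfl, rfl, h⟩ := sub_mem hs hi
    have hiN := hs.1 i hi
    dsimp only
    rw [smul_eq_mul]
    have e : r' + i + 1 = r' + (i + 1) := by ring
    rw [e]
    refine mul_mem (monomial_mem h _) ?_
    rcases hiN.eq_or_lt with h' | h'
    · simp [h']
    · exact Submodule.smul_mem _ _ (X_mem h')
  exact this hp

lemma D_mem {N M r : ℕ} {p : MvPolynomial ℕ ℚ} (hp : p ∈ V N M (r + 1)) :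
    D p ∈ V N M r := by
  have : V N M (r + 1) ≤ (V N M r).comap D.toLinearMap := by
    apply V_induction
    intro s hs
    change D (monomial s 1) ∈ V N M r
    rw [D, mkDerivation_monomial, one_smul]
    refine Submodule.sum_mem _ fun i hi => ?_
    obtain ⟨M', r', rfl, h2, h⟩ := sub_mem hs hi
    have hiN := hs.1 i hi
    dsimp only
    rw [smul_eq_mul]
    cases i with
    | zero => simp
    | succ i =>
      have e : r = r' + i := by omega
      rw [e]
      refine mul_mem (monomial_mem h _) ?_
      simp only [Nat.add_eq_zero_iff, one_ne_zero, and_false, if_false, Nat.add_sub_cancel]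
      exact X_mem (by omega)
  exact this hp

lemma D_zero {N M : ℕ} {p : MvPolynomial ℕ ℚ} (hp : p ∈ V N M 0) : D p = 0 := by
  have : V N M 0 ≤ LinearMap.ker D.toLinearMap := by
    apply V_induction
    intro s hs
    change D (monomial s 1) = 0
    rw [D, mkDerivation_monomial, one_smul]
    refine Finset.sum_eq_zero fun i hi => ?_
    obtain ⟨M', r', rfl, h2, h⟩ := sub_mem hs hi
    have : i = 0 := by omega
    simp [this]
  exact this hp

lemma FD_inj {N M : ℕ} : ∀ (r : ℕ) (_ : 2 * r ≤ N * M) (c : ℚ) (_ : 0 < c)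
    (p : MvPolynomial ℕ ℚ) (_ : p ∈ V N M r) (_ : F N (D p) + c • p = 0), p = 0 := by
  intro r
  induction r with
  | zero =>
    intro _ c hc p hp h
    rw [D_zero hp, map_zero, zero_add] at h
    exact (smul_eq_zero.1 h).resolve_left hc.ne'
  | succ r ih =>
    intro hr c hc p hp h
    have h1 : D (F N (D p) + c • p) = 0 := by rw [h, map_zero]
    rw [map_add, comm_apply, H_apply (D_mem hp), Derivation.map_smul, add_assoc, ← add_smul] at h1
    have hr' : (2 * (r : ℚ) + 2) ≤ N * M := by exact_mod_cast (by omega : 2 * r + 2 ≤ N * M)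
    have h2 := ih (by omega) _ (by linarith) _ (D_mem hp) h1
    rw [h2, map_zero, zero_add] at h
    exact (smul_eq_zero.1 h).resolve_left hc.ne'

lemma DF_inj {N M r : ℕ} (hr : 2 * r < N * M) {p : MvPolynomial ℕ ℚ} (hp : p ∈ V N M r)
    (h : D (F N p) = 0) : p = 0 := by
  rw [comm_apply, H_apply hp] at h
  have hr' : (2 * (r : ℚ)) < N * M := by exact_mod_cast hr
  exact FD_inj r hr.le _ (by linarith) p hp h

lemma sum_e {e g : ℕ → ℕ} {K : ℕ} (h : ∀ i < K, g i = e i + g (i + 1)) :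
    ∑ i ∈ Finset.range K, e i + g K = g 0 := by
  induction K with
  | zero => simp
  | succ K ih =>
    rw [Finset.sum_range_succ, add_assoc, ← h K (by omega)]
    exact ih fun i hi => h i (by omega)

lemma sum_ie {e g : ℕ → ℕ} {K : ℕ} (h : ∀ i < K, g i = e i + g (i + 1)) :
    ∑ i ∈ Finset.range K, e i * i + K * g K = ∑ i ∈ Finset.range K, g (i + 1) := by
  induction K with
  | zero => simp
  | succ K ih =>
    rw [Finset.sum_range_succ, Finset.sum_range_succ, ← ih fun i hi => h i (by omega),
      h K (by omega)]
    ring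

lemma degree_eq {N : ℕ} {s : ℕ →₀ ℕ} (h : ∀ i ∈ s.support, i ≤ N) :
    s.degree = ∑ i ∈ Finset.range (N + 1), s i := by
  rw [Finsupp.degree_apply]
  apply Finset.sum_subset
  · intro i hi
    have := h i hi
    simp; omega
  · simp

lemma weight_eq {N : ℕ} {s : ℕ →₀ ℕ} (h : ∀ i ∈ s.support, i ≤ N) :
    Finsupp.weight (fun i : ℕ => i) s = ∑ i ∈ Finset.range (N + 1), s i * i := by
  rw [Finsupp.weight_apply, Finsupp.sum]
  simp only [smul_eq_mul]
  apply Finset.sum_subset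
  · intro i hi
    have := h i hi
    simp; omega
  · intro i _ hi
    simp at hi
    simp [hi]

/-- The predicate counted by `gaussP`. -/
def PP (N M r : ℕ) (f : Fin N → Fin (M + 1)) : Prop :=
  (∀ i j : Fin N, i ≤ j → f j ≤ f i) ∧ ∑ i, (f i : ℕ) = r

/-- From exponents to a partition. -/
def toPart (M : ℕ) (s : ℕ →₀ ℕ) (i : ℕ) : ℕ := M - ∑ j ∈ Finset.range i, s j

lemma toPart_rec {N M r : ℕ} {s : ℕ →₀ ℕ} (hs : s ∈ monSet N M r) :
    ∀ i < N + 1, toPart M s i = s i + toPart M s (i + 1) := by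
  obtain ⟨h1, h2, h3⟩ := hs
  intro i hi
  rw [degree_eq h1] at h2
  have : ∑ j ∈ Finset.range (i + 1), s j ≤ ∑ j ∈ Finset.range (N + 1), s j :=
    Finset.sum_le_sum_of_subset (Finset.range_mono (by omega))
  rw [Finset.sum_range_succ] at this
  simp only [toPart, Finset.sum_range_succ]
  omega

lemma toPart_zero (M : ℕ) (s : ℕ →₀ ℕ) : toPart M s 0 = M := by simp [toPart]

lemma toPart_last {N M r : ℕ} {s : ℕ →₀ ℕ} (hs : s ∈ monSet N M r) :
    toPart M s (N + 1) = 0 := by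
  obtain ⟨h1, h2, h3⟩ := hs
  rw [degree_eq h1] at h2
  simp [toPart, h2]

lemma toPart_PP {N M r : ℕ} {s : ℕ →₀ ℕ} (hs : s ∈ monSet N M r) :
    PP N M r fun i => ⟨toPart M s (i + 1), by unfold toPart; omega⟩ := by
  constructor
  · intro i j hij
    simp only [Fin.mk_le_mk, toPart]
    apply Nat.sub_le_sub_left
    exact Finset.sum_le_sum_of_subset (Finset.range_mono (by simpa using hij))
  · dsimp only
    rw [Fin.sum_univ_eq_sum_range (fun i => toPart M s (i + 1))]
    have h := sum_ie (toPart_rec hs)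
    rw [← weight_eq hs.1, hs.2.2, Finset.sum_range_succ, toPart_last hs] at h
    simpa using h.symm

/-- The bijection. -/
def toP (N M r : ℕ) (s : monSet N M r) : {f // PP N M r f} := ⟨_, toPart_PP s.2⟩

lemma toP_inj (N M r : ℕ) : Function.Injective (toP N M r) := by
  rintro ⟨s, hs⟩ ⟨t, ht⟩ h
  have h' : ∀ i : Fin N, toPart M s (i + 1) = toPart M t (i + 1) := by
    intro i
    have := congrFun (congrArg Subtype.val h) i
    simpa [toP] using this
  have h2 : ∀ i ≤ N + 1, toPart M s i = toPart M t i := by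
    intro i hi
    rcases i with _ | i
    · simp [toPart_zero]
    · rcases (by omega : i < N ∨ i = N) with hi | rfl
      · exact h' ⟨i, hi⟩
      · rw [toPart_last hs, toPart_last ht]
  apply Subtype.ext
  ext i
  change s i = t i
  by_cases hi : i < N + 1
  · have a := toPart_rec hs i hi
    have b := toPart_rec ht i hi
    rw [h2 i (by omega), h2 (i + 1) (by omega)] at a
    omega
  · have a : s i = 0 := by
      by_contra hh
      exact hi (by have := hs.1 i (by simpa using hh); omega)
    have b : t i = 0 := by
      by_contra hh
      exact hi (by have := ht.1 i (by simpa using hh); omega)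
    rw [a, b]

lemma toP_surj (N M r : ℕ) : Function.Surjective (toP N M r) := by
  rintro ⟨f, hf1, hf2⟩
  let g : ℕ → ℕ := fun i => match i with
    | 0 => M
    | i + 1 => if h : i < N then (f ⟨i, h⟩ : ℕ) else 0
  have g0 : g 0 = M := rfl
  have gs : ∀ i (h : i < N), g (i + 1) = f ⟨i, h⟩ := fun i h => by simp [g, h]
  have gl : ∀ i, N < i → g i = 0 := by
    intro i hi
    rcases i with _ | i
    · omega
    · simp only [g]
      rw [dif_neg (by omega)]
  have ganti : ∀ i, g (i + 1) ≤ g i := by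
    intro i
    by_cases hi : i < N
    · rw [gs i hi]
      rcases i with _ | i
      · rw [g0]; have := (f ⟨0, hi⟩).2; omega
      · rw [gs i (by omega)]
        exact hf1 ⟨i, by omega⟩ ⟨i + 1, hi⟩ (by simp)
    · rw [gl (i + 1) (by omega)]; omega
  let s : ℕ →₀ ℕ := Finsupp.onFinset (Finset.range (N + 1)) (fun i => g i - g (i + 1)) (by
    intro i hi
    by_contra h
    simp at h
    rw [gl i (by omega)] at hi
    simp at hi)
  have hsa : ∀ i, s i = g i - g (i + 1) := fun i => rfl
  have hrec : ∀ i, g i = s i + g (i + 1) := by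
    intro i
    rw [hsa]
    have := ganti i
    omega
  have hsup : ∀ i ∈ s.support, i ≤ N := by
    intro i hi
    by_contra h
    have : s i ≠ 0 := by simpa using hi
    rw [hsa, gl i (by omega)] at this
    simp at this
  have hs : s ∈ monSet N M r := by
    refine ⟨hsup, ?_, ?_⟩
    · rw [degree_eq hsup]
      have := sum_e (e := s) (g := g) (K := N + 1) fun i _ => hrec i
      rw [gl (N + 1) (by omega), g0] at this
      simpa using this
    · rw [weight_eq hsup]
      have := sum_ie (e := s) (g := g) (K := N + 1) fun i _ => hrec i
      rw [Finset.sum_range_succ (fun i => g (i + 1)), gl (N + 1) (by omega)] at this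
      simp only [mul_zero, add_zero] at this
      rw [this, ← hf2, ← Fin.sum_univ_eq_sum_range (fun i => g (i + 1))]
      refine Finset.sum_congr rfl fun i _ => gs i i.2
  refine ⟨⟨s, hs⟩, ?_⟩
  apply Subtype.ext
  funext i
  apply Fin.ext
  change toPart M s (i + 1) = f i
  have := sum_e (e := s) (g := g) (K := i + 1) fun i _ => hrec i
  rw [g0, gs i i.2] at this
  unfold toPart
  change _ + (f i : ℕ) = M at this
  omega

instance (N M r : ℕ) : Finite (monSet N M r) := Finite.of_injective _ (toP_inj N M r)

lemma card_monSet (N M r : ℕ) : Nat.card (monSet N M r) = gaussP N M r := by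
  classical
  rw [Nat.card_congr (Equiv.ofBijective _ ⟨toP_inj N M r, toP_surj N M r⟩), Nat.card_eq_fintype_card,
    Fintype.card_subtype]
  unfold gaussP PP
  congr

instance (N M r : ℕ) : Module.Finite ℚ (V N M r) :=
  Module.Finite.of_basis (basisRestrictSupport ℚ (monSet N M r))

lemma finrank_V (N M r : ℕ) : Module.finrank ℚ (V N M r) = gaussP N M r := by
  rw [← card_monSet]
  exact Module.finrank_eq_nat_card_basis (basisRestrictSupport ℚ (monSet N M r))

/-- Highest weight vectors. -/
noncomputable def K (N M r : ℕ) : Submodule ℚ (MvPolynomial ℕ ℚ) :=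
  V N M r ⊓ LinearMap.ker D.toLinearMap

lemma mem_K {N M r : ℕ} {p : MvPolynomial ℕ ℚ} : p ∈ K N M r ↔ p ∈ V N M r ∧ D p = 0 := Iff.rfl

lemma gaussP_ge {N M r : ℕ} (hr : 2 * r < N * M) :
    gaussP N M r + Module.finrank ℚ (K N M (r + 1)) ≤ gaussP N M (r + 1) := by
  rw [← finrank_V, ← finrank_V]
  set W := (V N M r).map (F N).toLinearMap with hW
  have hWle : W ≤ V N M (r + 1) := by
    rintro _ ⟨p, hp, rfl⟩
    exact F_mem hp
  have hKle : K N M (r + 1) ≤ V N M (r + 1) := inf_le_left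
  have : Module.Finite ℚ (K N M (r + 1)) := Submodule.finiteDimensional_of_le hKle
  have : Module.Finite ℚ W := Submodule.finiteDimensional_of_le hWle
  have hinf : W ⊓ K N M (r + 1) = ⊥ := by
    rw [eq_bot_iff]
    rintro _ ⟨⟨p, hp, rfl⟩, hK⟩
    have := DF_inj hr hp hK.2
    simp [this]
  have hWr : Module.finrank ℚ W = Module.finrank ℚ (V N M r) := by
    have hinj : Function.Injective ((F N).toLinearMap.domRestrict (V N M r)) := by
      rw [← LinearMap.ker_eq_bot, eq_bot_iff]
      rintro ⟨p, hp⟩ h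
      have h' : F N p = 0 := h
      have := DF_inj hr hp (by rw [h', map_zero])
      simp [this]
    have := LinearMap.finrank_range_of_inj hinj
    rw [← this, LinearMap.range_domRestrict]
  have h1 := Submodule.finrank_sup_add_finrank_inf_eq W (K N M (r + 1))
  rw [hinf, finrank_bot, hWr] at h1
  have h2 := Submodule.finrank_mono (sup_le hWle hKle)
  omega

/-- Existence of a highest weight vector not divisible by `x_0`. -/
def Good (N M r : ℕ) : Prop := ∃ p ∈ K N M r, ¬ (X 0 : MvPolynomial ℕ ℚ) ∣ p

lemma Good.mul {N M r M' r' : ℕ} (h : Good N M r) (h' : Good N M' r') :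
    Good N (M + M') (r + r') := by
  obtain ⟨p, ⟨hp, hp'⟩, hpX⟩ := h
  obtain ⟨q, ⟨hq, hq'⟩, hqX⟩ := h'
  refine ⟨p * q, ⟨mul_mem hp hq, ?_⟩, ?_⟩
  · change D (p * q) = 0
    have hp' : D p = 0 := hp'
    have hq' : D q = 0 := hq'
    rw [Derivation.leibniz, hp', hq']
    simp
  · rw [X_dvd_mul_iff]
    tauto

lemma not_dvd {p : MvPolynomial ℕ ℚ} (x : ℕ → ℚ) (h0 : x 0 = 0) (h : eval x p ≠ 0) :
    ¬ (X 0 : MvPolynomial ℕ ℚ) ∣ p := by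
  rintro ⟨q, rfl⟩
  simp [h0] at h

/-- The quadratic highest weight vectors. -/
noncomputable def Q (t : ℕ) : MvPolynomial ℕ ℚ :=
  ∑ i ∈ Finset.range (t + 1), ((-1 : ℚ) ^ i) • (X i * X (t - i))

lemma Q_mem {N t : ℕ} (ht : t ≤ N) : Q t ∈ V N 2 t := by
  refine Submodule.sum_mem _ fun i hi => Submodule.smul_mem _ _ ?_
  simp at hi
  have := mul_mem (X_mem (N := N) (i := i) (by omega)) (X_mem (N := N) (i := t - i) (by omega))
  rwa [show i + (t - i) = t by omega] at this

lemma D_Q (t : ℕ) : D (Q t) = 0 := by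
  have h1 : ∑ i ∈ Finset.range (t + 1), ((-1 : ℚ) ^ i) • (X i * D (X (t - i))) =
      ∑ i ∈ Finset.range t, ((-1 : ℚ) ^ i) • ((X i : MvPolynomial ℕ ℚ) * X (t - (i + 1))) := by
    rw [Finset.sum_range_succ]
    simp only [Nat.sub_self, D_X_zero, mul_zero, smul_zero, add_zero]
    refine Finset.sum_congr rfl fun i hi => ?_
    simp at hi
    rw [show t - i = t - (i + 1) + 1 by omega, D_X_succ]
  have h2 : ∑ i ∈ Finset.range (t + 1), ((-1 : ℚ) ^ i) • (X (t - i) * D (X i)) =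
      - ∑ i ∈ Finset.range t, ((-1 : ℚ) ^ i) • ((X i : MvPolynomial ℕ ℚ) * X (t - (i + 1))) := by
    rw [Finset.sum_range_succ']
    simp only [D_X_zero, mul_zero, smul_zero, add_zero, D_X_succ]
    rw [← Finset.sum_neg_distrib]
    refine Finset.sum_congr rfl fun i hi => ?_
    rw [pow_succ, mul_neg_one, neg_smul, mul_comm]
  rw [Q, map_sum]
  simp only [Derivation.map_smul, Derivation.leibniz, smul_add, Finset.sum_add_distrib]
  simp only [smul_eq_mul]
  rw [h1, h2, add_neg_cancel]

lemma eval_Q (t : ℕ) (x : ℕ → ℚ) :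
    eval x (Q t) = ∑ i ∈ Finset.range (t + 1), (-1 : ℚ) ^ i * (x i * x (t - i)) := by
  simp [Q, smul_eval]

lemma Q_not_dvd {a : ℕ} (ha : 1 ≤ a) : ¬ (X 0 : MvPolynomial ℕ ℚ) ∣ Q (2 * a) := by
  apply not_dvd (fun i => if i = a then 1 else 0)
  · simp; omega
  · rw [eval_Q, Finset.sum_eq_single a]
    · simp [show 2 * a - a = a by omega]
    · intro b _ hb
      simp [hb]
    · intro h
      simp at h
      omega

lemma good_even {N a : ℕ} (ha : 1 ≤ a) (haN : 2 * a ≤ N) : Good N 2 (2 * a) :=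
  ⟨Q (2 * a), ⟨Q_mem haN, D_Q _⟩, Q_not_dvd ha⟩

lemma D_F_Q {N t : ℕ} (ht : t ≤ N) :
    D (F N (Q t)) = ((N : ℚ) * 2 - 2 * t) • Q t := by
  rw [comm_apply, D_Q, map_zero, zero_add, H_apply (Q_mem ht)]
  norm_num

lemma good_odd {N a : ℕ} (ha : 1 ≤ a) (haN : 2 * a + 1 ≤ N) : Good N 3 (2 * a + 1) := by
  have hQ : Q (2 * a) ∈ V N 2 (2 * a) := Q_mem (by omega)
  refine ⟨((N : ℚ) * 2 - 2 * (2 * a : ℕ)) • (Q (2 * a) * X 1) - X 0 * F N (Q (2 * a)),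
    ⟨?_, ?_⟩, ?_⟩
  · refine Submodule.sub_mem _ (Submodule.smul_mem _ _ ?_) ?_
    · exact mul_mem hQ (X_mem (by omega))
    · have := mul_mem (X_mem (N := N) (i := 0) (by omega)) (F_mem hQ)
      rw [zero_add] at this
      exact this
  · change D _ = 0
    have h1 : D (X 1) = X 0 := D_X_succ 0
    rw [map_sub, Derivation.map_smul, Derivation.leibniz, Derivation.leibniz, D_Q,
      D_F_Q (by omega), D_X_zero, h1]
    simp only [smul_eq_mul, add_zero, mul_zero]
    rw [mul_smul_comm, mul_comm (X 0), sub_self]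
  · intro h
    have h1 := (dvd_sub_left (dvd_mul_right (X 0) (F N (Q (2 * a))))).1 h
    rw [smul_eq_C_mul, X_dvd_mul_iff, X_dvd_mul_iff] at h1
    rcases h1 with h1 | h1 | h1
    · refine not_dvd (fun _ => 0) rfl ?_ h1
      have : (2 * a + 1 : ℚ) ≤ N := by exact_mod_cast haN
      simp only [eval_C]
      push_cast
      intro h
      linarith
    · exact Q_not_dvd ha h1
    · rw [X_dvd_X] at h1
      simp at h1

lemma eval_FQ (N t : ℕ) (x : ℕ → ℚ) :
    eval x (F N (Q t)) = ∑ i ∈ Finset.range (t + 1), (-1 : ℚ) ^ i *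
      (x i * ((((t - i : ℕ) : ℚ) + 1) * ((N : ℚ) - (t - i : ℕ)) * x (t - i + 1)) +
        x (t - i) * (((i : ℚ) + 1) * ((N : ℚ) - i) * x (i + 1))) := by
  simp only [Q, map_sum, Derivation.map_smul, Derivation.leibniz, F_X, smul_eval, smul_eq_mul,
    map_add, map_mul, eval_X]

lemma good_four {a : ℕ} (ha : 2 ≤ a) : Good (2 * a + 1) 4 (2 * (2 * a + 1)) := by
  set N := 2 * a + 1 with hN
  have hQ : Q (2 * a) ∈ V N 2 (2 * a) := Q_mem (by omega)
  have hDF : D (F N (Q (2 * a))) = (2 : ℚ) • Q (2 * a) := by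
    rw [D_F_Q (by omega), hN]
    congr 1
    push_cast
    ring
  have hDFF : D (F N (F N (Q (2 * a)))) = (2 : ℚ) • F N (Q (2 * a)) := by
    rw [comm_apply, hDF, H_apply (F_mem hQ), Derivation.map_smul, hN]
    push_cast
    rw [show ((2 : ℚ) * a + 1) * 2 - 2 * (2 * a + 1) = 0 by ring, zero_smul, add_zero]
  refine ⟨(2 : ℚ) • (Q (2 * a) * F N (F N (Q (2 * a)))) - F N (Q (2 * a)) * F N (Q (2 * a)),
    ⟨?_, ?_⟩, ?_⟩
  · refine Submodule.sub_mem _ (Submodule.smul_mem _ _ ?_) ?_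
    · have := mul_mem hQ (F_mem (F_mem hQ))
      rwa [show 2 * a + (2 * a + 1 + 1) = 2 * N by omega] at this
    · have := mul_mem (F_mem hQ) (F_mem hQ)
      rwa [show 2 * a + 1 + (2 * a + 1) = 2 * N by omega] at this
  · change D _ = 0
    rw [map_sub, Derivation.map_smul, Derivation.leibniz, Derivation.leibniz, hDFF, hDF, D_Q]
    simp only [smul_eq_mul, mul_zero, add_zero, mul_smul_comm]
    rw [mul_comm (F N (Q (2 * a))) (Q (2 * a)), smul_smul, ← add_smul]
    norm_num
  · let x : ℕ → ℚ := fun i => if i = 1 ∨ i = 2 * a then 1 else 0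
    apply not_dvd x
    · simp [x]; omega
    have hx : ∀ i, ¬ (i = 1 ∨ i = 2 * a) → x i = 0 := fun i hi => if_neg hi
    have hx1 : x 1 = 1 := if_pos (Or.inl rfl)
    have hx2 : x (2 * a) = 1 := if_pos (Or.inr rfl)
    have e1 : eval x (Q (2 * a)) = 0 := by
      rw [eval_Q]
      refine Finset.sum_eq_zero fun i hi => ?_
      simp at hi
      by_cases h : i = 1 ∨ i = 2 * a
      · rw [hx (2 * a - i) (by omega)]; ring
      · rw [hx i h]; ring
    have e2 : eval x (F N (Q (2 * a))) = 2 * N - 8 * a := by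
      rw [eval_FQ]
      have : ∀ i ∈ Finset.range (2 * a + 1), i ∉ ({0, 1, 2 * a - 1, 2 * a} : Finset ℕ) →
        (-1 : ℚ) ^ i *
      (x i * ((((2 * a - i : ℕ) : ℚ) + 1) * ((N : ℚ) - (2 * a - i : ℕ)) * x (2 * a - i + 1)) +
        x (2 * a - i) * (((i : ℚ) + 1) * ((N : ℚ) - i) * x (i + 1))) = 0 := by
        intro i hi hi'
        simp at hi hi'
        rw [hx i (by omega), hx (2 * a - i) (by omega)]
        ring
      rw [← Finset.sum_subset ?_ this]
      · rw [Finset.sum_insert (by simp; omega), Finset.sum_insert (by simp; omega),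
          Finset.sum_insert (by simp; omega), Finset.sum_singleton]
        rw [Nat.sub_zero, Nat.sub_self, hx 0 (by omega), hx (2 * a - 1) (by omega),
          show 2 * a - 1 + 1 = 2 * a by omega, show 2 * a - (2 * a - 1) = 1 by omega,
          hx2, zero_add, hx1, hx (1 + 1) (by omega)]
        have h1 : (-1 : ℚ) ^ (2 * a) = 1 := by simp
        have h2 : (-1 : ℚ) ^ (2 * a - 1) = -1 := Odd.neg_one_pow ⟨a - 1, by omega⟩
        have h3 : ((2 * a - 1 : ℕ) : ℚ) = 2 * a - 1 := by
          rw [Nat.cast_sub (by omega)]; push_cast; ring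
        rw [h1, h2, h3, hN]
        push_cast
        ring
      · intro i hi
        simp at hi ⊢
        omega
    rw [map_sub, smul_eval, map_mul, map_mul, e1, e2, hN]
    have ha' : (2 : ℚ) ≤ a := by exact_mod_cast ha
    push_cast
    intro h
    nlinarith

lemma good_zero (N : ℕ) : Good N 0 0 := by
  refine ⟨1, ⟨one_mem, ?_⟩, not_dvd (fun _ => 0) rfl (by simp)⟩
  change D 1 = 0
  simp

lemma good_main {N : ℕ} (hN : 5 ≤ N) : ∀ k r : ℕ, 2 * k ≤ r → r ≤ k * N →
    Good N (2 * k) r ∨ Good N (2 * k + 1) r := by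
  intro k
  induction k using Nat.strong_induction_on with
  | _ k ih =>
  intro r h1 h2
  rcases k with _ | _ | k
  · have : r = 0 := by omega
    subst this
    exact Or.inl (good_zero N)
  · rcases Nat.even_or_odd' r with ⟨a, rfl | rfl⟩
    · exact Or.inl (good_even (by omega) (by omega))
    · exact Or.inr (good_odd (by omega) (by omega))
  · have key : ∀ a, 1 ≤ a → 2 * a ≤ N → 2 * (k + 1) + 2 * a ≤ r → r ≤ (k + 1) * N + 2 * a →
        Good N (2 * (k + 1 + 1)) r ∨ Good N (2 * (k + 1 + 1) + 1) r := by
      intro a ha1 ha2 ha3 ha4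
      have e : 2 * a + (r - 2 * a) = r := by omega
      rcases ih (k + 1) (by omega) (r - 2 * a) (by omega) (by omega) with h | h
      · left
        have := (good_even ha1 ha2).mul h
        rw [e] at this
        convert this using 1
        omega
      · right
        have := (good_even ha1 ha2).mul h
        rw [e] at this
        convert this using 1
        omega
    have e1 : (k + 1 + 1) * N = (k + 1) * N + N := by ring
    by_cases hc : r ≤ (k + 1) * N + 2
    · exact key 1 le_rfl (by omega) (by omega) (by omega)
    have hkN : k * 5 ≤ k * N := Nat.mul_le_mul_left k hN
    have e2 : (k + 1) * N = k * N + N := by ring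
    rcases Nat.even_or_odd' N with ⟨b, hb | hb⟩
    · exact key b (by omega) (by omega) (by omega) (by omega)
    · by_cases hr : r = (k + 1 + 1) * N
      · have h4 : Good N 4 (2 * N) := by
          rw [hb]
          exact good_four (by omega)
        have e : 2 * N + k * N = r := by rw [hr]; ring
        rcases ih k (by omega) (k * N) (by omega) le_rfl with h | h
        · left
          have := h4.mul h
          rw [e] at this
          convert this using 1
          omega
        · right
          have := h4.mul h
          rw [e] at this
          convert this using 1
          omega
      · exact key b (by omega) (by omega) (by omega) (by omega)

lemma lin_indep {d : ℕ} (e : Fin d → ℕ) (he : Function.Injective e)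
    (h : Fin d → MvPolynomial ℕ ℚ) (hh : ∀ i, ¬ (X 0 : MvPolynomial ℕ ℚ) ∣ h i) :
    LinearIndependent ℚ (fun i => X 0 ^ e i * h i) := by
  rw [Fintype.linearIndependent_iff]
  intro g hg
  by_contra! hne
  obtain ⟨i1, hi1⟩ := hne
  obtain ⟨i0, hi0, hmin⟩ := Finset.exists_min_image (Finset.univ.filter fun i => g i ≠ 0) e
    ⟨i1, by simpa using hi1⟩
  simp at hi0 hmin
  rw [← Finset.add_sum_erase _ _ (Finset.mem_univ i0)] at hg
  have hd : (X 0 : MvPolynomial ℕ ℚ) ^ (e i0 + 1) ∣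
      ∑ i ∈ Finset.univ.erase i0, g i • (X 0 ^ e i * h i) := by
    refine Finset.dvd_sum fun i hi => ?_
    simp at hi
    by_cases hgi : g i = 0
    · simp [hgi]
    · have h1 := hmin i hgi
      have h2 : e i ≠ e i0 := fun h => hi (he h)
      rw [smul_eq_C_mul]
      exact ((pow_dvd_pow _ (by omega)).mul_right _).mul_left _
  have hd2 : (X 0 : MvPolynomial ℕ ℚ) ^ (e i0 + 1) ∣ g i0 • (X 0 ^ e i0 * h i0) := by
    rw [eq_neg_of_add_eq_zero_left hg]
    exact hd.neg_right
  rw [← mul_smul_comm, pow_succ, mul_dvd_mul_iff_left (pow_ne_zero _ (X_ne_zero 0)),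
    smul_eq_C_mul, X_dvd_mul_iff] at hd2
  rcases hd2 with hd2 | hd2
  · exact not_dvd (fun _ => 0) rfl (by simpa using hi0) hd2
  · exact hh i0 hd2

lemma X_pow_mem_K (N j : ℕ) : (X 0 : MvPolynomial ℕ ℚ) ^ j ∈ V N j 0 ∧
    D ((X 0 : MvPolynomial ℕ ℚ) ^ j) = 0 := by
  constructor
  · induction j with
    | zero => exact one_mem
    | succ j ih => exact mul_mem ih (X_mem (by omega))
  · rw [Derivation.leibniz_pow]
    simp

lemma finrank_K_ge {N M r d k0 : ℕ} (hN : 5 ≤ N) (h1 : 2 * (k0 + d) ≤ r) (h2 : r ≤ (k0 + 1) * N)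
    (h3 : 2 * (k0 + d) + 1 ≤ M) : d ≤ Module.finrank ℚ (K N M r) := by
  have hg : ∀ i : Fin d, ∃ δ, (δ = 2 * (k0 + 1 + i) ∨ δ = 2 * (k0 + 1 + i) + 1) ∧ Good N δ r := by
    intro i
    have hi := i.2
    have h4 : (k0 + 1) * N ≤ (k0 + 1 + i) * N := Nat.mul_le_mul_right _ (by omega)
    rcases good_main hN (k0 + 1 + i) r (by omega) (by omega) with h | h
    · exact ⟨_, Or.inl rfl, h⟩
    · exact ⟨_, Or.inr rfl, h⟩
  choose δ hδ hgood using hg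
  choose p hp hpX using hgood
  have hδM : ∀ i, δ i ≤ M := by
    intro i
    have hi := i.2
    have := hδ i
    omega
  have hli := lin_indep (fun i => M - δ i) (by
    intro i j hij
    dsimp only at hij
    have := hδ i
    have := hδ j
    have := hδM i
    have := hδM j
    apply Fin.ext
    omega) p hpX
  have hfin : Module.Finite ℚ (K N M r) := Submodule.finiteDimensional_of_le
    (inf_le_left : K N M r ≤ V N M r)
  have hc := finrank_span_eq_card hli
  rw [Fintype.card_fin] at hc
  rw [← hc]
  apply Submodule.finrank_mono
  rw [Submodule.span_le]
  rintro _ ⟨i, rfl⟩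
  obtain ⟨ha, hb⟩ := X_pow_mem_K N (M - δ i)
  obtain ⟨hc, hd⟩ := mem_K.1 (hp i)
  refine mem_K.2 ⟨?_, ?_⟩
  · have := mul_mem ha hc
    rwa [Nat.sub_add_cancel (hδM i), zero_add] at this
  · rw [Derivation.leibniz, hb, hd]
    simp

end GP

theorem stmt8 (d m n r : ℕ) (hd : 1 ≤ d) (hm : 8 * d ≤ m) (hn : 2 * d + 1 ≤ n)
    (hr1 : 2 * d ≤ r) (hr2 : 2 * r ≤ m * (n - 2 * d)) :
    gaussP m n (r - 1) + d ≤ gaussP m n r := by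
  obtain ⟨c, rfl⟩ : ∃ c, n = c + 2 * d := ⟨n - 2 * d, by omega⟩
  rw [Nat.add_sub_cancel] at hr2
  obtain ⟨s, rfl⟩ : ∃ s, r = s + 1 := ⟨r - 1, by omega⟩
  -- `k0 = ⌈r / m⌉ - 1`
  set k0 := s / m with hk0
  have hm0 : 0 < m := by omega
  have e1 : m * k0 + s % m = s := Nat.div_add_mod s m
  have e2 : s % m < m := Nat.mod_lt _ hm0
  have e3 : (k0 + 1) * m = m * k0 + m := by ring
  have hA : 2 * (k0 + d) ≤ s + 1 := by
    rcases Nat.eq_zero_or_pos k0 with h | h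
    · omega
    · obtain ⟨t, ht⟩ : ∃ t, k0 = t + 1 := ⟨k0 - 1, by omega⟩
      have : 8 * t ≤ m * t := Nat.mul_le_mul_right t (by omega)
      rw [ht, Nat.mul_add] at e1
      omega
  have hB : 2 * k0 < c := by
    have : m * (2 * k0) < m * c := by
      have : m * (2 * k0) = 2 * (m * k0) := by ring
      omega
    exact Nat.lt_of_mul_lt_mul_left this
  have hK := GP.finrank_K_ge (N := m) (M := c + 2 * d) (r := s + 1) (d := d) (k0 := k0)
    (by omega) hA (by omega) (by omega)
  have e4 : m * (c + 2 * d) = m * c + m * (2 * d) := by ring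
  have := GP.gaussP_ge (N := m) (M := c + 2 * d) (r := s) (by omega)
  rw [Nat.add_sub_cancel]
  omega
end

section
/- Let m ≥ 4 and n be positive integers and let N_3(m,n) be the number of triples (d_0, d_1, d_2) of positive integers with d_0 + 2d_1 + 3d_2 = n and m·d_0 ≤ (m−4)·d_2 + 1. Then for every integer r with max(1, 2n−4) ≤ r and 2r ≤ mn, one has p_r(m,n) − p_{r−1}(m,n) ≥ N_3(m,n). -/
open MvPolynomial in
/-- lowering derivation -/
noncomputable def lowD : Derivation ℚ (MvPolynomial ℕ ℚ) (MvPolynomial ℕ ℚ) :=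
  MvPolynomial.mkDerivation ℚ (fun i => (i : ℚ) • X (i - 1))

open MvPolynomial in
/-- raising derivation -/
noncomputable def raiseU (m : ℕ) : Derivation ℚ (MvPolynomial ℕ ℚ) (MvPolynomial ℕ ℚ) :=
  MvPolynomial.mkDerivation ℚ (fun i => ((m : ℚ) - i) • X (i + 1))

/-- exponents of monomials -/
def XS (m n r : ℕ) : Set (ℕ →₀ ℕ) :=
  {s | (∀ i, m < i → s i = 0) ∧ s.degree = n ∧ Finsupp.weight (fun i : ℕ => i) s = r}

/-- the weight space -/
noncomputable def VS (m n r : ℕ) : Submodule ℚ (MvPolynomial ℕ ℚ) :=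
  MvPolynomial.restrictSupport ℚ (XS m n r)

open MvPolynomial in
theorem comm_eq (m : ℕ) (p : MvPolynomial ℕ ℚ) :
    lowD (raiseU m p) - raiseU m (lowD p) =
      MvPolynomial.mkDerivation ℚ (fun i : ℕ => ((m : ℚ) - 2 * (i : ℚ)) • (X i : MvPolynomial ℕ ℚ)) p := by
  rw [← Derivation.commutator_apply]
  congr 1
  apply MvPolynomial.derivation_ext
  intro i
  rw [Derivation.commutator_apply]
  simp only [lowD, raiseU, mkDerivation_X, Derivation.map_smul, smul_smul]
  rcases i with _ | i
  · simp
  · simp only [Nat.add_sub_cancel, ← sub_smul]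
    congr 1
    push_cast
    ring

open MvPolynomial in
theorem VS_induct {m n r : ℕ} {W : Submodule ℚ (MvPolynomial ℕ ℚ)}
    (L : MvPolynomial ℕ ℚ →ₗ[ℚ] MvPolynomial ℕ ℚ)
    (h : ∀ s ∈ XS m n r, L (monomial s 1) ∈ W) {p : MvPolynomial ℕ ℚ} (hp : p ∈ VS m n r) :
    L p ∈ W := by
  rw [VS, restrictSupport_eq_span] at hp
  have : Submodule.span ℚ ((fun s => monomial s (1:ℚ)) '' XS m n r) ≤ W.comap L := by
    rw [Submodule.span_le]
    rintro _ ⟨s, hs, rfl⟩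
    exact h s hs
  exact this hp

open MvPolynomial in
theorem comm_VS {m n r : ℕ} {p : MvPolynomial ℕ ℚ} (hp : p ∈ VS m n r) :
    lowD (raiseU m p) - raiseU m (lowD p) = ((m : ℚ) * n - 2 * r) • p := by
  rw [comm_eq]
  have := VS_induct (W := ⊥)
    ((MvPolynomial.mkDerivation ℚ (fun i : ℕ => ((m : ℚ) - 2 * (i : ℚ)) • (X i : MvPolynomial ℕ ℚ))).toLinearMap
      - ((m : ℚ) * n - 2 * r) • LinearMap.id) (m := m) (n := n) (r := r) ?_ hp
  · simpa [sub_eq_zero] using this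
  · intro s hs
    obtain ⟨h1, h2, h3⟩ := hs
    simp only [LinearMap.sub_apply, Derivation.coeFn_coe, mkDerivation_monomial, Submodule.mem_bot,
      LinearMap.smul_apply, LinearMap.id_apply, one_smul]
    have e : ∀ i ∈ s.support, (monomial (s - Finsupp.single i 1) ((s i : ℕ) : ℚ)) •
        (((m : ℚ) - 2 * i) • (X i : MvPolynomial ℕ ℚ)) =
        ((s i : ℚ) * ((m : ℚ) - 2 * i)) • monomial s (1 : ℚ) := by
      intro i hi
      have : s - Finsupp.single i 1 + Finsupp.single i 1 = s := by
        apply tsub_add_cancel_of_le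
        simp only [Finsupp.single_le_iff]
        have := Finsupp.mem_support_iff.mp hi
        omega
      rw [smul_eq_mul, mul_smul_comm, X, monomial_mul, this, smul_monomial, smul_monomial]
      congr 1
      simp [mul_comm]
    rw [Finsupp.sum, Finset.sum_congr rfl e, ← Finset.sum_smul, ← sub_smul]
    have : ∑ i ∈ s.support, (s i : ℚ) * ((m : ℚ) - 2 * i) - ((m : ℚ) * n - 2 * r) = 0 := by
      rw [← h2, ← h3, Finsupp.degree_apply, Finsupp.weight_apply, Finsupp.sum]
      push_cast
      simp only [mul_sub, Finset.sum_sub_distrib, Finset.mul_sum, smul_eq_mul]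
      push_cast
      rw [sub_eq_zero]
      congr 1
      · exact Finset.sum_congr rfl (fun i _ => by ring)
      · exact Finset.sum_congr rfl (fun i _ => by ring)
    rw [this, zero_smul]

open MvPolynomial in
theorem lowD_mem {m n r : ℕ} {p : MvPolynomial ℕ ℚ} (hp : p ∈ VS m n (r + 1)) :
    lowD p ∈ VS m n r := by
  refine VS_induct lowD.toLinearMap ?_ hp
  rintro s ⟨h1, h2, h3⟩
  simp only [Derivation.coeFn_coe, lowD, mkDerivation_monomial, one_smul]
  refine Submodule.sum_mem _ (fun i hi => ?_)
  have hi' := Finsupp.mem_support_iff.mp hi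
  have : s - Finsupp.single i 1 + Finsupp.single i 1 = s := by
    apply tsub_add_cancel_of_le
    simp only [Finsupp.single_le_iff]
    omega
  beta_reduce
  set u := s - Finsupp.single i 1 with hu
  rw [smul_eq_mul, mul_smul_comm, X, monomial_mul]
  rcases i with _ | i
  · simp
  refine Submodule.smul_mem _ _ ((monomial_mem_restrictSupport _).mpr (Or.inl ⟨?_, ?_, ?_⟩))
  · intro j hj
    have a1 := h1 j hj
    have a2 : i + 1 ≤ m := by
      by_contra hc
      exact hi' (h1 _ (by omega))
    rw [← this] at a1
    simp only [Finsupp.add_apply, Nat.add_sub_cancel] at a1 ⊢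
    rw [Finsupp.single_apply, if_neg (by omega)]
    omega
  · rw [← this] at h2
    simpa using h2
  · rw [← this] at h3
    simp only [map_add, Finsupp.weight_single, smul_eq_mul, Nat.add_sub_cancel] at h3 ⊢
    omega

open MvPolynomial in
theorem raiseU_mem {m n r : ℕ} {p : MvPolynomial ℕ ℚ} (hp : p ∈ VS m n r) :
    raiseU m p ∈ VS m n (r + 1) := by
  refine VS_induct (raiseU m).toLinearMap ?_ hp
  rintro s ⟨h1, h2, h3⟩
  simp only [Derivation.coeFn_coe, raiseU, mkDerivation_monomial, one_smul]
  refine Submodule.sum_mem _ (fun i hi => ?_)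
  have hi' := Finsupp.mem_support_iff.mp hi
  have : s - Finsupp.single i 1 + Finsupp.single i 1 = s := by
    apply tsub_add_cancel_of_le
    simp only [Finsupp.single_le_iff]
    omega
  beta_reduce
  set u := s - Finsupp.single i 1 with hu
  rw [smul_eq_mul, mul_smul_comm, X, monomial_mul]
  by_cases him : i = m
  · simp [him]
  refine Submodule.smul_mem _ _ ((monomial_mem_restrictSupport _).mpr (Or.inl ⟨?_, ?_, ?_⟩))
  · intro j hj
    have a1 := h1 j hj
    have a2 : i ≤ m := by
      by_contra hc
      exact hi' (h1 _ (by omega))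
    rw [← this] at a1
    simp only [Finsupp.add_apply] at a1 ⊢
    rw [Finsupp.single_apply, if_neg (by omega)]
    omega
  · rw [← this] at h2
    simpa using h2
  · rw [← this] at h3
    simp only [map_add, Finsupp.weight_single, smul_eq_mul] at h3 ⊢
    omega

open MvPolynomial in
theorem lowD_zero {m n : ℕ} {p : MvPolynomial ℕ ℚ} (hp : p ∈ VS m n 0) :
    lowD p = 0 := by
  have := VS_induct (W := ⊥) lowD.toLinearMap ?_ hp
  · simpa using this
  rintro s ⟨h1, h2, h3⟩
  simp only [Derivation.coeFn_coe, lowD, mkDerivation_monomial, one_smul]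
  refine Submodule.sum_mem _ (fun i hi => ?_)
  have hi' := Finsupp.mem_support_iff.mp hi
  rw [Finsupp.weight_apply, Finsupp.sum, Finset.sum_eq_zero_iff] at h3
  have := h3 i hi
  have h0 : i = 0 := by
    simp only [smul_eq_mul, mul_eq_zero] at this
    tauto
  subst h0
  simp

theorem DU_inj (m n : ℕ) : ∀ (r : ℕ) (c : ℚ) (_ : 0 ≤ c) (_ : 2 * r < m * n)
    (p : MvPolynomial ℕ ℚ) (_ : p ∈ VS m n r) (_ : lowD (raiseU m p) + c • p = 0), p = 0 := by
  intro r
  induction r with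
  | zero =>
    intro c hc hr p hp h
    have h1 := comm_VS hp
    rw [lowD_zero hp, map_zero, sub_zero] at h1
    rw [h1, ← add_smul, smul_eq_zero] at h
    have : (0 : ℚ) < (m : ℚ) * n := by exact_mod_cast (by omega : 0 < m * n)
    rcases h with h | h
    · push_cast at h
      linarith
    · exact h
  | succ r ih =>
    intro c hc hr p hp h
    have h1 := comm_VS hp
    have hpos : (0 : ℚ) < (m : ℚ) * n - 2 * ((r + 1 : ℕ) : ℚ) := by
      have : ((2 * (r + 1) : ℕ) : ℚ) < ((m * n : ℕ) : ℚ) := by exact_mod_cast hr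
      push_cast at this ⊢
      linarith
    set k : ℚ := (m : ℚ) * n - 2 * ((r + 1 : ℕ) : ℚ)
    have h2 : raiseU m (lowD p) + (k + c) • p = 0 := by
      rw [add_smul, ← h1, ← h]
      abel
    have h3 : lowD p = 0 := by
      refine ih (k + c) (by linarith) (by omega) _ (lowD_mem hp) ?_
      rw [← Derivation.map_smul, ← map_add, h2, map_zero]
    rw [h3, map_zero, zero_add, smul_eq_zero] at h2
    rcases h2 with h2 | h2
    · linarith
    · exact h2
/-- extended partition sequence -/
def extF (m n : ℕ) (f : Fin m → Fin (n + 1)) (i : ℕ) : ℕ :=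
  if i = 0 then n else if h : i - 1 < m then (f ⟨i - 1, h⟩ : ℕ) else 0

theorem extF_zero (m n : ℕ) (f : Fin m → Fin (n + 1)) : extF m n f 0 = n := by simp [extF]

theorem extF_succ (m n : ℕ) (f : Fin m → Fin (n + 1)) (i : Fin m) :
    extF m n f (i + 1) = f i := by simp [extF]

theorem extF_big (m n : ℕ) (f : Fin m → Fin (n + 1)) (i : ℕ) (h : m < i) :
    extF m n f i = 0 := by
  rw [extF, if_neg (by omega), dif_neg (by omega)]

theorem extF_anti (m n : ℕ) (f : Fin m → Fin (n + 1))
    (hf : ∀ i j : Fin m, i ≤ j → f j ≤ f i) (i : ℕ) : extF m n f (i + 1) ≤ extF m n f i := by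
  by_cases h : i < m
  · have := extF_succ m n f ⟨i, h⟩
    simp only at this
    rw [this]
    rcases i with _ | i
    · rw [extF_zero]
      exact Nat.lt_succ_iff.mp (f _).2
    · have h2 := extF_succ m n f ⟨i, by omega⟩
      simp only at h2
      rw [h2]
      apply hf
      simp
  · rw [extF_big _ _ _ _ (by omega)]
    exact Nat.zero_le _

theorem tele1 (F : ℕ → ℕ) (hF : ∀ i, F (i + 1) ≤ F i) (k : ℕ) :
    ∑ i ∈ Finset.range k, (F i - F (i + 1)) + F k = F 0 := by
  induction k with
  | zero => simp
  | succ k ih =>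
    rw [Finset.sum_range_succ]
    have := hF k
    omega

theorem tele2 (F : ℕ → ℕ) (hF : ∀ i, F (i + 1) ≤ F i) (k : ℕ) :
    ∑ i ∈ Finset.range k, (F i - F (i + 1)) * i + k * F k = ∑ i ∈ Finset.range k, F (i + 1) := by
  induction k with
  | zero => simp
  | succ k ih =>
    rw [Finset.sum_range_succ, Finset.sum_range_succ, ← ih]
    obtain ⟨c, hc⟩ := Nat.exists_eq_add_of_le (hF k)
    rw [hc]
    simp only [Nat.add_sub_cancel_left]
    ring

/-- the exponent of a partition -/
noncomputable def toX (m n : ℕ) (f : Fin m → Fin (n + 1)) : ℕ →₀ ℕ :=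
  Finsupp.onFinset (Finset.range (m + 1)) (fun i => extF m n f i - extF m n f (i + 1)) (by
    intro i hi
    by_contra hc
    rw [Finset.mem_range] at hc
    rw [extF_big _ _ _ i (by omega)] at hi
    simp at hi)

theorem toX_apply (m n : ℕ) (f : Fin m → Fin (n + 1)) (i : ℕ) :
    toX m n f i = extF m n f i - extF m n f (i + 1) := rfl

theorem XS_iff (m n r : ℕ) (s : ℕ →₀ ℕ) : s ∈ XS m n r ↔ (∀ i, m < i → s i = 0) ∧
    ∑ i ∈ Finset.range (m + 1), s i = n ∧ ∑ i ∈ Finset.range (m + 1), s i * i = r := by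
  refine and_congr_right (fun h => ?_)
  have hs : s.support ⊆ Finset.range (m + 1) := by
    intro i hi
    rw [Finsupp.mem_support_iff] at hi
    rw [Finset.mem_range]
    by_contra hc
    exact hi (h i (by omega))
  rw [Finsupp.degree_apply, Finsupp.weight_apply, Finsupp.sum,
    Finset.sum_subset hs (by intro i _ hi; simpa using hi),
    Finset.sum_subset hs (by intro i _ hi; simp at hi; simp [hi])]
  simp

theorem toX_mem (m n r : ℕ) (f : Fin m → Fin (n + 1))
    (hf : ∀ i j : Fin m, i ≤ j → f j ≤ f i) :
    toX m n f ∈ XS m n r ↔ ∑ i, (f i : ℕ) = r := by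
  rw [XS_iff]
  have h1 := tele1 _ (extF_anti m n f hf) (m + 1)
  have h2 := tele2 _ (extF_anti m n f hf) (m + 1)
  rw [extF_big _ _ _ (m + 1) (by omega), extF_zero] at h1
  rw [extF_big _ _ _ (m + 1) (by omega), Finset.sum_range_succ (fun i => extF m n f (i + 1)),
    extF_big _ _ _ (m + 1) (by omega), ← Fin.sum_univ_eq_sum_range (fun i => extF m n f (i + 1))] at h2
  simp only [extF_succ, add_zero, mul_zero] at h1 h2
  simp only [toX_apply, h1, h2, true_and]
  refine ⟨fun h => h.2, fun h => ⟨fun i hi => ?_, h⟩⟩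
  rw [extF_big _ _ _ i hi, Nat.zero_sub]

theorem toX_bij (m n r : ℕ) : Function.Bijective
    (fun f : {f : Fin m → Fin (n + 1) // (∀ i j : Fin m, i ≤ j → f j ≤ f i) ∧ ∑ i, (f i : ℕ) = r} =>
      (⟨toX m n f.1, (toX_mem m n r f.1 f.2.1).mpr f.2.2⟩ : XS m n r)) := by
  constructor
  · rintro ⟨f, hf, hfr⟩ ⟨g, hg, hgr⟩ h
    simp only [Subtype.mk.injEq] at h ⊢
    have key : ∀ i, extF m n f i = extF m n g i := by
      intro i
      induction i with
      | zero => simp [extF_zero]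
      | succ i ih =>
        have h1 := DFunLike.congr_fun h i
        rw [toX_apply, toX_apply] at h1
        have h2 := extF_anti m n f hf i
        have h3 := extF_anti m n g hg i
        omega
    funext i
    apply Fin.ext
    rw [← extF_succ, ← extF_succ, key]
  · rintro ⟨s, hs⟩
    have hs' := (XS_iff m n r s).mp hs
    obtain ⟨h1, h2, h3⟩ := hs'
    let f : Fin m → Fin (n + 1) := fun j => ⟨n - ∑ k ∈ Finset.range (j + 1), s k, by omega⟩
    have hf : ∀ i j : Fin m, i ≤ j → f j ≤ f i := by
      intro i j hij
      change n - _ ≤ n - _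
      apply Nat.sub_le_sub_left
      apply Finset.sum_le_sum_of_subset
      intro x hx
      simp only [Finset.mem_range] at hx ⊢
      have : (i : ℕ) ≤ j := hij
      omega
    have hle : ∀ i, ∑ k ∈ Finset.range i, s k ≤ n := by
      intro i
      rw [← h2]
      apply Finset.sum_le_sum_of_ne_zero
      intro x _ hx
      rw [Finset.mem_range]
      by_contra hc
      exact hx (h1 x (by omega))
    have hext : ∀ i, extF m n f i = n - ∑ k ∈ Finset.range i, s k := by
      intro i
      rcases i with _ | i
      · simp [extF_zero]
      · by_cases h : i < m
        · exact extF_succ m n f ⟨i, h⟩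
        · rw [extF_big _ _ _ _ (by omega)]
          have : n ≤ ∑ k ∈ Finset.range (i + 1), s k := by
            conv_lhs => rw [← h2]
            apply Finset.sum_le_sum_of_subset
            intro x hx
            simp only [Finset.mem_range] at hx ⊢
            omega
          omega
    have heq : toX m n f = s := by
      ext i
      rw [toX_apply, hext, hext]
      have := hle (i + 1)
      rw [Finset.sum_range_succ] at this ⊢
      omega
    refine ⟨⟨f, hf, ?_⟩, ?_⟩
    · rw [← toX_mem m n r f hf, heq]
      exact hs
    · exact Subtype.ext heq

theorem card_XS (m n r : ℕ) : Nat.card (XS m n r) = gaussP m n r := by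
  rw [← Nat.card_eq_of_bijective _ (toX_bij m n r), gaussP, Nat.card_eq_fintype_card,
    Fintype.card_subtype]

instance finite_XS (m n r : ℕ) : Finite (XS m n r) :=
  Finite.of_surjective _ (toX_bij m n r).2

instance finite_VS (m n r : ℕ) : Module.Finite ℚ (VS m n r) :=
  Module.Finite.of_basis (MvPolynomial.basisRestrictSupport ℚ (XS m n r))

theorem finrank_VS (m n r : ℕ) : Module.finrank ℚ (VS m n r) = gaussP m n r := by
  rw [← card_XS]
  exact Module.finrank_eq_nat_card_basis (MvPolynomial.basisRestrictSupport ℚ (XS m n r))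

theorem main_bound_s9 (m n r : ℕ) (hr : 2 * r < m * n) {ι : Type*} [Finite ι]
    (v : ι → MvPolynomial ℕ ℚ) (hv : ∀ i, v i ∈ VS m n (r + 1)) (hD : ∀ i, lowD (v i) = 0)
    (hli : LinearIndependent ℚ v) : gaussP m n r + Nat.card ι ≤ gaussP m n (r + 1) := by
  have := Fintype.ofFinite ι
  let L : VS m n r →ₗ[ℚ] MvPolynomial ℕ ℚ := (raiseU m).toLinearMap.domRestrict (VS m n r)
  have hinj0 : ∀ x : VS m n r, lowD (L x) = 0 → x = 0 := by
    intro x hx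
    have := DU_inj m n r 0 le_rfl hr x.1 x.2 (by rw [zero_smul, add_zero]; exact hx)
    exact Subtype.ext this
  have hinj : Function.Injective L := by
    rw [← LinearMap.ker_eq_bot, LinearMap.ker_eq_bot']
    intro x hx
    apply hinj0
    rw [hx, map_zero]
  have h1 : Module.finrank ℚ (LinearMap.range L) = gaussP m n r := by
    rw [LinearMap.finrank_range_of_inj hinj, finrank_VS]
  have h2 : Module.finrank ℚ (Submodule.span ℚ (Set.range v)) = Nat.card ι := by
    rw [finrank_span_eq_card hli, Nat.card_eq_fintype_card]
  have hs : Submodule.span ℚ (Set.range v) ≤ LinearMap.ker lowD.toLinearMap := by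
    rw [Submodule.span_le]
    rintro _ ⟨i, rfl⟩
    exact hD i
  have hdis : LinearMap.range L ⊓ Submodule.span ℚ (Set.range v) = ⊥ := by
    rw [Submodule.eq_bot_iff]
    rintro _ ⟨⟨x, rfl⟩, h⟩
    have := hinj0 x (hs h)
    rw [this, map_zero]
  have hle : LinearMap.range L ⊔ Submodule.span ℚ (Set.range v) ≤ VS m n (r + 1) := by
    refine sup_le ?_ ?_
    · rintro _ ⟨x, rfl⟩
      exact raiseU_mem x.2
    · rw [Submodule.span_le]
      rintro _ ⟨i, rfl⟩
      exact hv i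
  have hfin : Module.Finite ℚ (Submodule.span ℚ (Set.range v)) :=
    Module.Finite.span_of_finite ℚ (Set.finite_range v)
  have h3 := Submodule.finrank_sup_add_finrank_inf_eq (LinearMap.range L) (Submodule.span ℚ (Set.range v))
  rw [hdis, finrank_bot, h1, h2, add_zero] at h3
  rw [← h3, ← finrank_VS m n (r + 1)]
  exact Submodule.finrank_mono hle
set_option linter.unusedSectionVars false

section graphs

variable {ι : Type*} [Fintype ι] [DecidableEq ι]

open MvPolynomial in
/-- umbral map -/
noncomputable def Psi : MvPolynomial ι ℚ →ₗ[ℚ] MvPolynomial ℕ ℚ :=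
  (basisMonomials ι ℚ).constr ℚ (fun e => ∏ v, X (e v))

open MvPolynomial in
theorem Psi_monomial (e : ι →₀ ℕ) (c : ℚ) : Psi (monomial e c) = c • ∏ v, X (e v) := by
  have : monomial e c = c • basisMonomials ι ℚ e := by simp [smul_monomial]
  rw [this, map_smul, Psi, Module.Basis.constr_basis]

/-- sum of partial derivatives -/
noncomputable def transD : Derivation ℚ (MvPolynomial ι ℚ) (MvPolynomial ι ℚ) :=
  MvPolynomial.mkDerivation ℚ (fun _ => 1)

theorem deriv_prod {A B : Type*} [CommRing A] [Algebra ℚ A] [DecidableEq B]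
    (D : Derivation ℚ A A) (s : Finset B) (f : B → A) :
    D (∏ v ∈ s, f v) = ∑ v ∈ s, (∏ w ∈ s.erase v, f w) * D (f v) := by
  induction s using Finset.induction_on with
  | empty => simp
  | insert a s ha ih =>
    rw [Finset.prod_insert ha, Derivation.leibniz, ih, Finset.sum_insert ha, Finset.erase_insert ha,
      add_comm, smul_eq_mul, smul_eq_mul, Finset.mul_sum]
    congr 1
    refine Finset.sum_congr rfl (fun v hv => ?_)
    have hne : v ≠ a := by rintro rfl; exact ha hv
    rw [Finset.erase_insert_of_ne hne.symm, Finset.prod_insert (by simp [ha])]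
    ring

open MvPolynomial in
theorem lowD_Psi (P : MvPolynomial ι ℚ) : lowD (Psi P) = Psi (transD P) := by
  have : (lowD.toLinearMap ∘ₗ Psi) = (Psi ∘ₗ (transD (ι := ι)).toLinearMap) := by
    apply MvPolynomial.basisMonomials ι ℚ |>.ext
    intro e
    simp only [coe_basisMonomials, LinearMap.comp_apply, Derivation.coeFn_coe, Psi_monomial, one_smul,
      transD, mkDerivation_monomial]
    rw [deriv_prod, Finsupp.sum, map_sum]
    symm
    apply Finset.sum_subset_zero_on_sdiff (Finset.subset_univ _)
    · intro v hv
      have : e v = 0 := by simpa using hv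
      simp [this, lowD]
    · intro v _
      rw [smul_eq_mul, mul_one, Psi_monomial, ← Finset.mul_prod_erase Finset.univ _ (Finset.mem_univ v)]
      rw [lowD, mkDerivation_X, mul_smul_comm, mul_comm]
      congr 2
      · refine Finset.prod_congr rfl (fun w hw => ?_)
        have : v ≠ w := (Finset.ne_of_mem_erase hw).symm
        simp [this]
      · simp
  exact LinearMap.congr_fun this P

open MvPolynomial in
theorem Psi_mem (P : MvPolynomial ι ℚ) (m r : ℕ)
    (h : ∀ e ∈ P.support, (∀ v, e v ≤ m) ∧ e.degree = r) :
    Psi P ∈ VS m (Fintype.card ι) r := by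
  rw [P.as_sum, map_sum]
  refine Submodule.sum_mem _ (fun e he => ?_)
  obtain ⟨h1, h2⟩ := h e he
  rw [Psi_monomial]
  apply Submodule.smul_mem
  have : ∏ v, (X (e v) : MvPolynomial ℕ ℚ) = monomial (∑ v, Finsupp.single (e v) 1) 1 := by
    rw [monomial_sum_one]
    rfl
  rw [this]
  refine (monomial_mem_restrictSupport _).mpr (Or.inl ⟨?_, ?_, ?_⟩)
  · intro i hi
    rw [Finsupp.finsetSum_apply]
    apply Finset.sum_eq_zero
    intro v _
    rw [Finsupp.single_apply, if_neg]
    have := h1 v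
    omega
  · simp
  · rw [map_sum]
    simp only [Finsupp.weight_single, smul_eq_mul, one_mul]
    rw [← h2, Finsupp.degree_eq_sum]

/-- content of a colouring -/
noncomputable def content (c : ι → Fin 3) : Fin 3 →₀ ℕ := ∑ v, Finsupp.single (c v) 1

theorem content_apply (c : ι → Fin 3) (k : Fin 3) :
    content c k = (Finset.univ.filter (fun v => c v = k)).card := by
  rw [content, Finsupp.finsetSum_apply, Finset.card_filter]
  exact Finset.sum_congr rfl (fun v _ => Finsupp.single_apply)

/-- linear functional -/
noncomputable def ell (z : Fin 3 → ℚ) (μ : Fin 3 →₀ ℕ) : MvPolynomial ℕ ℚ →ₗ[ℚ] ℚ :=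
  MvPolynomial.lcoeff ℚ μ ∘ₗ (MvPolynomial.aeval (fun k => ∑ a : Fin 3, MvPolynomial.C (z a ^ k) * (MvPolynomial.X a : MvPolynomial (Fin 3) ℚ))).toLinearMap

open MvPolynomial in
theorem ell_Psi (z : Fin 3 → ℚ) (μ : Fin 3 →₀ ℕ) (P : MvPolynomial ι ℚ) :
    ell z μ (Psi P) = ∑ c : ι → Fin 3, if content c = μ then eval (fun v => z (c v)) P else 0 := by
  have hL : (ell z μ) ∘ₗ Psi = ∑ c : ι → Fin 3, if content c = μ then
      (aeval (R := ℚ) (fun v => z (c v))).toLinearMap else 0 := by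
    apply (MvPolynomial.basisMonomials ι ℚ).ext
    intro e
    simp only [coe_basisMonomials, LinearMap.comp_apply, Psi_monomial, one_smul, ell,
      AlgHom.toLinearMap_apply, map_prod, aeval_X, LinearMap.sum_apply]
    rw [Finset.prod_univ_sum, Fintype.piFinset_univ, map_sum]
    refine Finset.sum_congr rfl (fun c _ => ?_)
    rw [Finset.prod_mul_distrib, ← map_prod]
    have : ∏ v, (X (c v) : MvPolynomial (Fin 3) ℚ) = monomial (content c) 1 := by
      rw [content, monomial_sum_one]
      rfl
    rw [this, lcoeff_apply, coeff_C_mul, coeff_monomial]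
    split_ifs
    · simp [aeval_monomial, Finsupp.prod_fintype]
    · simp
  have := LinearMap.congr_fun hL P
  rw [LinearMap.comp_apply] at this
  rw [this, LinearMap.sum_apply]
  refine Finset.sum_congr rfl (fun c _ => ?_)
  split_ifs
  · simp [aeval_eq_eval]
  · simp

/-- product of differences along edges -/
noncomputable def PE (E : Multiset (ι × ι)) : MvPolynomial ι ℚ :=
  (E.map (fun p => MvPolynomial.X p.1 - MvPolynomial.X p.2)).prod

/-- degree of a vertex -/
def degE (E : Multiset (ι × ι)) (v : ι) : ℕ :=
  (E.map (fun p => (if p.1 = v then 1 else 0) + (if p.2 = v then 1 else 0))).sum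

theorem transD_PE (E : Multiset (ι × ι)) : transD (PE E) = 0 := by
  induction E using Multiset.induction_on with
  | empty => simp [PE]
  | cons p E ih =>
    rw [PE, Multiset.map_cons, Multiset.prod_cons, Derivation.leibniz]
    rw [PE] at ih
    rw [ih]
    simp [transD, MvPolynomial.mkDerivation_X]

open MvPolynomial in
theorem degreeOf_PE (E : Multiset (ι × ι)) (v : ι) : degreeOf v (PE E) ≤ degE E v := by
  induction E using Multiset.induction_on with
  | empty => simp [PE, degE]
  | cons p E ih =>
    rw [PE, degE, Multiset.map_cons, Multiset.prod_cons, Multiset.map_cons, Multiset.sum_cons]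
    refine (degreeOf_mul_le _ _ _).trans (add_le_add ?_ ih)
    refine (degreeOf_sub_le _ _ _).trans ?_
    rw [degreeOf_X, degreeOf_X]
    simp only [eq_comm (a := v)]
    exact max_le (Nat.le_add_right _ _) (Nat.le_add_left _ _)

open MvPolynomial in
theorem homog_PE (E : Multiset (ι × ι)) : (PE E).IsHomogeneous (Multiset.card E) := by
  induction E using Multiset.induction_on with
  | empty => simpa [PE] using isHomogeneous_one ι ℚ
  | cons p E ih =>
    rw [PE, Multiset.map_cons, Multiset.prod_cons, Multiset.card_cons, add_comm]
    exact ((isHomogeneous_X _ _).sub (isHomogeneous_X _ _)).mul ih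

open MvPolynomial in
theorem Psi_PE_mem (E : Multiset (ι × ι)) (m : ℕ) (h : ∀ v, degE E v ≤ m) :
    Psi (PE E) ∈ VS m (Fintype.card ι) (Multiset.card E) := by
  apply Psi_mem
  intro e he
  refine ⟨fun v => ((monomial_le_degreeOf v he).trans (degreeOf_PE E v)).trans (h v), ?_⟩
  have := homog_PE E (mem_support_iff.mp he)
  rw [← this, Finsupp.degree_eq_weight_one]
  rfl

theorem eval_PE (E : Multiset (ι × ι)) (x : ι → ℚ) :
    MvPolynomial.eval x (PE E) = (E.map (fun p => x p.1 - x p.2)).prod := by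
  rw [PE, map_multiset_prod, Multiset.map_map]
  simp

theorem eval_PE_ne (E : Multiset (ι × ι)) (z : Fin 3 → ℚ) (hz : Function.Injective z)
    (c : ι → Fin 3) :
    MvPolynomial.eval (fun v => z (c v)) (PE E) ≠ 0 ↔ ∀ p ∈ E, c p.1 ≠ c p.2 := by
  rw [eval_PE, ne_eq, Multiset.prod_eq_zero_iff]
  simp only [Multiset.mem_map, sub_eq_zero, hz.eq_iff]
  push Not
  rfl

end graphs
section extra

variable {ι : Type*} [Fintype ι] [DecidableEq ι]

theorem degE_zero (v : ι) : degE (0 : Multiset (ι × ι)) v = 0 := rfl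

theorem degE_cons (p : ι × ι) (E : Multiset (ι × ι)) (v : ι) :
    degE (p ::ₘ E) v = (if p.1 = v then 1 else 0) + (if p.2 = v then 1 else 0) + degE E v := by
  rw [degE, Multiset.map_cons, Multiset.sum_cons, degE]

theorem degE_add (E F : Multiset (ι × ι)) (v : ι) : degE (E + F) v = degE E v + degE F v := by
  rw [degE, Multiset.map_add, Multiset.sum_add, degE, degE]

theorem degE_replicate (k : ℕ) (p : ι × ι) (v : ι) :
    degE (Multiset.replicate k p) v =
      k * ((if p.1 = v then 1 else 0) + (if p.2 = v then 1 else 0)) := by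
  rw [degE, Multiset.map_replicate, Multiset.sum_replicate, smul_eq_mul]

theorem sum_ind (col : ι → Fin 3) (u : ι) (k : Fin 3) :
    ∑ v with col v = k, (if u = v then 1 else 0) = if col u = k then 1 else 0 := by
  rw [Finset.sum_ite_eq]
  simp

theorem classDeg (col : ι → Fin 3) (E : Multiset (ι × ι)) (k : Fin 3) :
    ∑ v with col v = k, degE E v = degE (E.map (fun p => (col p.1, col p.2))) k := by
  induction E using Multiset.induction_on with
  | empty => simp [degE]
  | cons p E ih =>
    rw [Multiset.map_cons, degE_cons, ← ih]
    simp only [degE_cons, Finset.sum_add_distrib, sum_ind]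

theorem extra_edges (col : ι → Fin 3) (F : Multiset (Fin 3 × Fin 3)) :
    ∀ (cap : ι → ℕ) (_ : ∀ p ∈ F, p.1 ≠ p.2) (_ : ∀ k, degE F k ≤ ∑ v with col v = k, cap v),
    ∃ E : Multiset (ι × ι), Multiset.card E = Multiset.card F ∧ (∀ p ∈ E, col p.1 ≠ col p.2) ∧
      ∀ v, degE E v ≤ cap v := by
  induction F using Multiset.induction_on with
  | empty =>
    intro cap _ _
    exact ⟨0, by simp, by simp, by simp [degE]⟩
  | cons p F ih =>
    intro cap hp hd
    have hne := hp p (Multiset.mem_cons_self _ _)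
    have ex : ∀ k, (p.1 = k ∨ p.2 = k) → ∃ u, col u = k ∧ 0 < cap u := by
      intro k hk
      by_contra hc
      push Not at hc
      have h0 : ∑ v with col v = k, cap v = 0 := by
        apply Finset.sum_eq_zero
        intro v hv
        have := hc v (Finset.mem_filter.mp hv).2
        omega
      have h1 := hd k
      rw [h0, degE_cons] at h1
      rcases hk with hk | hk
      · rw [if_pos hk] at h1
        omega
      · rw [if_pos hk] at h1
        omega
    obtain ⟨u, hu, hcu⟩ := ex p.1 (Or.inl rfl)
    obtain ⟨w, hw, hcw⟩ := ex p.2 (Or.inr rfl)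
    have huw : u ≠ w := by
      rintro rfl
      exact hne (hu.symm.trans hw)
    let cap' : ι → ℕ := fun v => cap v - ((if u = v then 1 else 0) + (if w = v then 1 else 0))
    have hcap : ∀ v, cap v = (if u = v then 1 else 0) + (if w = v then 1 else 0) + cap' v := by
      intro v
      change _ = _ + (cap v - _)
      by_cases h1 : u = v
      · subst h1
        rw [if_pos rfl, if_neg huw.symm]
        omega
      · by_cases h2 : w = v
        · subst h2
          rw [if_pos rfl, if_neg h1]
          omega
        · rw [if_neg h1, if_neg h2]
          omega
    obtain ⟨E, hE1, hE2, hE3⟩ := ih cap' (fun q hq => hp q (Multiset.mem_cons_of_mem hq)) (by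
      intro k
      have h1 := hd k
      rw [degE_cons] at h1
      simp only [hcap, Finset.sum_add_distrib, sum_ind, hu, hw] at h1
      omega)
    refine ⟨(u, w) ::ₘ E, by simp [hE1], ?_, ?_⟩
    · intro q hq
      rw [Multiset.mem_cons] at hq
      rcases hq with rfl | hq
      · simpa [hu, hw] using hne
      · exact hE2 q hq
    · intro v
      rw [degE_cons, hcap v]
      have := hE3 v
      simp only
      omega

end extra

theorem coloring (a b c : ℕ) (hab : b < a) (hbc : c < b) (x y w : ℕ → ℕ)
    (hy : ∀ i, b ≤ i → y i = 3) (hw : ∀ i, c ≤ i → w i = 3)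
    (hw2 : ∀ i, i < c → w i ≤ 2)
    (e1 : ∀ i, i < b → x i ≠ y i) (e2 : ∀ i, i < b → x (i + 1) ≠ y i)
    (e3 : ∀ i, i < c → x i ≠ w i) (e4 : ∀ i, i < c → x (i + 1) ≠ w i)
    (e5 : ∀ i, i < c → y i ≠ w i) (e6 : ∀ i, i < c → y (i + 1) ≠ w i)
    (μ : ℕ → ℕ)
    (hμ : ∀ j, j ≤ 2 → μ j = ∑ i ∈ Finset.range a,
      ((if x i = j then 1 else 0) + (if y i = j then 1 else 0) + (if w i = j then 1 else 0))) :
    μ 0 ≤ a ∧ (μ 0 = a → μ 1 ≤ b ∧ (μ 1 = b →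
      (∀ i, i < a → x i = 0) ∧ (∀ i, i < b → y i = 1) ∧ (∀ i, i < c → w i = 2))) := by
  have t0 : ∀ j, j ≤ 2 → ∀ i ∈ Finset.range a,
      ((if x i = j then 1 else 0) + (if y i = j then 1 else 0) + (if w i = j then 1 else 0)) ≤ 1 := by
    intro j hj i _
    have := hy i
    have := hw i
    have := e1 i
    have := e3 i
    have := e5 i
    split_ifs <;> omega
  have s1 : ∑ i ∈ Finset.range a, 1 = a := by simp
  refine ⟨?_, ?_⟩
  · rw [hμ 0 (by omega)]
    exact (Finset.sum_le_sum (t0 0 (by omega))).trans s1.le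
  intro h0
  rw [hμ 0 (by omega)] at h0
  have h0' := (Finset.sum_eq_sum_iff_of_le (t0 0 (by omega))).mp (h0.trans s1.symm)
  have hx : ∀ d i, i + d + 1 = a → x i = 0 := by
    intro d
    induction d with
    | zero =>
      intro i hi
      have h1 := h0' i (by simp; omega)
      have := hy i (by omega)
      have := hw i (by omega)
      split_ifs at h1 <;> omega
    | succ d ih =>
      intro i hi
      have h1 := h0' i (by simp; omega)
      have h2 := ih (i + 1) (by omega)
      have := hy i
      have := hw i
      have := e2 i
      have := e4 i
      split_ifs at h1 <;> omega
  have hx' : ∀ i, i < a → x i = 0 := fun i hi => hx (a - 1 - i) i (by omega)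
  have t1 : ∀ i ∈ Finset.range a,
      ((if x i = 1 then 1 else 0) + (if y i = 1 then 1 else 0) + (if w i = 1 then 1 else 0)) ≤
        if i < b then 1 else 0 := by
    intro i hi
    have := hy i
    have := hw i
    have := hx' i (by simpa using hi)
    have := e5 i
    split_ifs <;> omega
  have s2 : ∑ i ∈ Finset.range a, (if i < b then 1 else 0) = b := by
    rw [← Finset.card_filter]
    have : (Finset.range a).filter (fun i => i < b) = Finset.range b := by
      ext i
      simp only [Finset.mem_filter, Finset.mem_range]
      omega
    rw [this, Finset.card_range]
  refine ⟨?_, ?_⟩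
  · rw [hμ 1 (by omega)]
    exact (Finset.sum_le_sum t1).trans s2.le
  intro h1
  rw [hμ 1 (by omega)] at h1
  have h1' := (Finset.sum_eq_sum_iff_of_le t1).mp (h1.trans s2.symm)
  have hyy : ∀ d i, i + d + 1 = b → y i = 1 := by
    intro d
    induction d with
    | zero =>
      intro i hi
      have h1 := h1' i (by simp; omega)
      have := hx' i (by omega)
      have := hw i (by omega)
      split_ifs at h1 <;> omega
    | succ d ih =>
      intro i hi
      have h1 := h1' i (by simp; omega)
      have h2 := ih (i + 1) (by omega)
      have := hx' i (by omega)
      have := hw i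
      have := e6 i
      split_ifs at h1 <;> omega
  have hy' : ∀ i, i < b → y i = 1 := fun i hi => hyy (b - 1 - i) i (by omega)
  refine ⟨hx', hy', fun i hi => ?_⟩
  have := hx' i (by omega)
  have := hy' i (by omega)
  have := hw2 i hi
  have := e3 i hi
  have := e5 i hi
  omega
/-- vertices of the graph -/
abbrev Vx (ℓ : Fin 3 → ℕ) := (k : Fin 3) × Fin (ℓ k)

/-- edges between two rows -/
def edgeM (ℓ : Fin 3 → ℕ) (k k' : Fin 3) (h : ℓ k' < ℓ k) : Multiset (Vx ℓ × Vx ℓ) :=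
  (Finset.univ : Finset (Fin (ℓ k'))).val.map
    (fun i : Fin (ℓ k') => ((⟨k, ⟨i.1, i.2.trans h⟩⟩ : Vx ℓ), (⟨k', i⟩ : Vx ℓ))) +
  (Finset.univ : Finset (Fin (ℓ k'))).val.map
    (fun i : Fin (ℓ k') =>
      ((⟨k, ⟨i.1 + 1, Nat.lt_of_le_of_lt i.2 h⟩⟩ : Vx ℓ), (⟨k', i⟩ : Vx ℓ)))

theorem sum_inj_le (ℓ : Fin 3 → ℕ) {l : ℕ} (g : Fin l → Vx ℓ) (hg : Function.Injective g)
    (k : Fin 3) (hk : ∀ i, (g i).1 = k) (v : Vx ℓ) :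
    ∑ i, (if g i = v then 1 else 0) ≤ if v.1 = k then 1 else 0 := by
  rw [← Finset.card_filter]
  split_ifs with h
  · rw [Finset.card_le_one]
    intro i hi j hj
    simp only [Finset.mem_filter, Finset.mem_univ, true_and] at hi hj
    exact hg (hi.trans hj.symm)
  · rw [Nat.le_zero, Finset.card_eq_zero, Finset.filter_eq_empty_iff]
    intro i _ hi
    apply h
    rw [← hi, hk]

theorem degE_map_le (ℓ : Fin 3 → ℕ) {l : ℕ} (g g' : Fin l → Vx ℓ) (hg : Function.Injective g)
    (hg' : Function.Injective g')
    (k k' : Fin 3) (hk : ∀ i, (g i).1 = k) (hk' : ∀ i, (g' i).1 = k') (v : Vx ℓ) :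
    degE ((Finset.univ : Finset (Fin l)).val.map (fun i => (g i, g' i))) v ≤
      (if v.1 = k then 1 else 0) + if v.1 = k' then 1 else 0 := by
  rw [degE, Multiset.map_map]
  change ∑ i, ((if g i = v then 1 else 0) + (if g' i = v then 1 else 0)) ≤ _
  rw [Finset.sum_add_distrib]
  exact add_le_add (sum_inj_le ℓ g hg k hk v) (sum_inj_le ℓ g' hg' k' hk' v)

theorem degE_edgeM (ℓ : Fin 3 → ℕ) (k k' : Fin 3) (h : ℓ k' < ℓ k) (v : Vx ℓ) :
    degE (edgeM ℓ k k' h) v ≤ 2 * ((if v.1 = k then 1 else 0) + if v.1 = k' then 1 else 0) := by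
  rw [edgeM, degE_add, two_mul]
  refine add_le_add (degE_map_le ℓ (fun i : Fin (ℓ k') => (⟨k, ⟨i.1, i.2.trans h⟩⟩ : Vx ℓ))
      (fun i => ⟨k', i⟩) ?_ ?_ k k' (fun _ => rfl) (fun _ => rfl) v)
    (degE_map_le ℓ (fun i : Fin (ℓ k') => (⟨k, ⟨i.1 + 1, Nat.lt_of_le_of_lt i.2 h⟩⟩ : Vx ℓ))
      (fun i => ⟨k', i⟩) ?_ ?_ k k' (fun _ => rfl) (fun _ => rfl) v)
  all_goals
    intro i j hij
    simpa [Fin.ext_iff] using hij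

theorem edgeM_map (ℓ : Fin 3 → ℕ) (k k' : Fin 3) (h : ℓ k' < ℓ k) :
    (edgeM ℓ k k' h).map (fun p => (p.1.1, p.2.1)) = Multiset.replicate (2 * ℓ k') (k, k') := by
  rw [edgeM, Multiset.map_add, Multiset.map_map, Multiset.map_map, two_mul, Multiset.replicate_add]
  refine congrArg₂ _ ?_ ?_ <;>
    exact (Multiset.map_const' (Finset.univ : Finset (Fin (ℓ k'))).val (k, k')).trans
      (by rw [Finset.card_val, Finset.card_univ, Fintype.card_fin])

theorem edgeM_card (ℓ : Fin 3 → ℕ) (k k' : Fin 3) (h : ℓ k' < ℓ k) :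
    Multiset.card (edgeM ℓ k k' h) = 2 * ℓ k' := by
  have := congrArg Multiset.card (edgeM_map ℓ k k' h)
  simpa using this

theorem edgeM_mem1 (ℓ : Fin 3 → ℕ) (k k' : Fin 3) (h : ℓ k' < ℓ k) (i : ℕ) (hi : i < ℓ k') :
    ((⟨k, ⟨i, by omega⟩⟩ : Vx ℓ), (⟨k', ⟨i, hi⟩⟩ : Vx ℓ)) ∈ edgeM ℓ k k' h := by
  rw [edgeM, Multiset.mem_add]
  left
  rw [Multiset.mem_map]
  exact ⟨⟨i, hi⟩, by simp, rfl⟩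

theorem edgeM_mem2 (ℓ : Fin 3 → ℕ) (k k' : Fin 3) (h : ℓ k' < ℓ k) (i : ℕ) (hi : i < ℓ k') :
    ((⟨k, ⟨i + 1, by omega⟩⟩ : Vx ℓ), (⟨k', ⟨i, hi⟩⟩ : Vx ℓ)) ∈ edgeM ℓ k k' h := by
  rw [edgeM, Multiset.mem_add]
  right
  rw [Multiset.mem_map]
  exact ⟨⟨i, hi⟩, by simp, rfl⟩

/-- base graph -/
def baseE (ℓ : Fin 3 → ℕ) (h1 : ℓ 1 < ℓ 0) (h2 : ℓ 2 < ℓ 1) : Multiset (Vx ℓ × Vx ℓ) :=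
  edgeM ℓ 0 1 h1 + edgeM ℓ 0 2 (h2.trans h1) + edgeM ℓ 1 2 h2

theorem degE_baseE (ℓ : Fin 3 → ℕ) (h1 : ℓ 1 < ℓ 0) (h2 : ℓ 2 < ℓ 1) (v : Vx ℓ) :
    degE (baseE ℓ h1 h2) v ≤ 4 := by
  rw [baseE, degE_add, degE_add]
  have a1 := degE_edgeM ℓ 0 1 h1 v
  have a2 := degE_edgeM ℓ 0 2 (h2.trans h1) v
  have a3 := degE_edgeM ℓ 1 2 h2 v
  generalize v.1 = k at a1 a2 a3
  fin_cases k <;> simp at a1 a2 a3 <;> omega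

theorem card_class (ℓ : Fin 3 → ℕ) (k : Fin 3) :
    (Finset.univ.filter (fun v : Vx ℓ => v.1 = k)).card = ℓ k := by
  rw [Finset.card_filter, Fintype.sum_sigma]
  rw [Finset.sum_eq_single k]
  · simp
  · intro b _ hb
    simp [hb]
  · simp

theorem exists_graph (m r : ℕ) (ℓ : Fin 3 → ℕ) (hm : 4 ≤ m) (h1 : ℓ 1 < ℓ 0) (h2 : ℓ 2 < ℓ 1)
    (hr : 2 * ℓ 1 + 4 * ℓ 2 ≤ r) (hr2 : 2 * r ≤ m * (ℓ 0 + ℓ 1 + ℓ 2))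
    (hl : m * ℓ 0 + 4 * ℓ 2 ≤ m * ℓ 1 + m * ℓ 2 + 1) :
    ∃ E : Multiset (Vx ℓ × Vx ℓ), baseE ℓ h1 h2 ≤ E ∧ Multiset.card E = r ∧
      (∀ p ∈ E, p.1.1 ≠ p.2.1) ∧ ∀ v, degE E v ≤ m := by
  set B := baseE ℓ h1 h2 with hB
  let cap : Vx ℓ → ℕ := fun v => m - degE B v
  have hcap : ∀ v, cap v + degE B v = m := by
    intro v
    have := degE_baseE ℓ h1 h2 v
    rw [← hB] at this
    change m - degE B v + degE B v = m
    omega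
  have hS : ∀ k : Fin 3, ∑ v : Vx ℓ with v.1 = k, cap v +
      degE (B.map (fun p => (p.1.1, p.2.1))) k = m * ℓ k := by
    intro k
    rw [← classDeg (fun v : Vx ℓ => v.1) B k, ← Finset.sum_add_distrib]
    simp only [hcap, Finset.sum_const, card_class, smul_eq_mul, mul_comm]
  have hBm : B.map (fun p => (p.1.1, p.2.1)) = Multiset.replicate (2 * ℓ 1) (0, 1) +
      Multiset.replicate (2 * ℓ 2) (0, 2) + Multiset.replicate (2 * ℓ 2) (1, 2) := by
    rw [hB, baseE, Multiset.map_add, Multiset.map_add, edgeM_map, edgeM_map, edgeM_map]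
  have hBc : Multiset.card B = 2 * ℓ 1 + 4 * ℓ 2 := by
    rw [hB, baseE, Multiset.card_add, Multiset.card_add, edgeM_card, edgeM_card, edgeM_card]
    ring
  have hS0 := hS 0
  have hS1 := hS 1
  have hS2 := hS 2
  rw [hBm] at hS0 hS1 hS2
  simp only [degE_add, degE_replicate] at hS0 hS1 hS2
  simp at hS0 hS1 hS2
  have hx1 : m * ℓ 1 ≤ m * ℓ 0 := Nat.mul_le_mul_left _ h1.le
  have hx2 : m * ℓ 2 + 4 ≤ m * ℓ 1 := by
    have : m * (ℓ 2 + 1) ≤ m * ℓ 1 := Nat.mul_le_mul_left _ h2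
    rw [mul_add] at this
    omega
  have hx3 : 2 * ℓ 1 + m * ℓ 2 ≤ m * ℓ 1 + 2 * ℓ 2 := by
    obtain ⟨q, rfl⟩ := Nat.exists_eq_add_of_le hm
    have : (2 + q) * ℓ 2 ≤ (2 + q) * ℓ 1 := Nat.mul_le_mul_left _ h2.le
    linarith
  rw [mul_add, mul_add] at hr2
  set S0 := ∑ v : Vx ℓ with v.1 = 0, cap v with hS0d
  set S1 := ∑ v : Vx ℓ with v.1 = 1, cap v with hS1d
  set S2 := ∑ v : Vx ℓ with v.1 = 2, cap v with hS2d
  generalize m * ℓ 0 = A0 at *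
  generalize m * ℓ 1 = A1 at *
  generalize m * ℓ 2 = A2 at *
  obtain ⟨t, rfl⟩ := Nat.exists_eq_add_of_le hr
  obtain ⟨α, β, γ, g0, g1, g2, g3⟩ : ∃ α β γ : ℕ, α + β + γ = t ∧ α + β ≤ S0 ∧ α + γ ≤ S1 ∧
      β + γ ≤ S2 := by
    refine ⟨t - (t - S1) - (t - S0), t - S1, t - S0, ?_, ?_, ?_, ?_⟩ <;> omega
  obtain ⟨X, hX1, hX2, hX3⟩ := extra_edges (fun v : Vx ℓ => v.1)
    (Multiset.replicate α (0, 1) + Multiset.replicate β (0, 2) + Multiset.replicate γ (1, 2))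
    cap (by
      intro p hp
      simp only [Multiset.mem_add, Multiset.mem_replicate] at hp
      rcases hp with (⟨_, rfl⟩ | ⟨_, rfl⟩) | ⟨_, rfl⟩ <;> decide) (by
      intro k
      simp only [degE_add, degE_replicate]
      fin_cases k
      · simpa using g1
      · simpa using g2
      · simpa using g3)
  refine ⟨B + X, Multiset.le_add_right _ _, ?_, ?_, ?_⟩
  · rw [Multiset.card_add, hBc, hX1]
    simp
    omega
  · intro p hp
    rw [Multiset.mem_add] at hp
    rcases hp with hp | hp
    · have : (p.1.1, p.2.1) ∈ B.map (fun p => (p.1.1, p.2.1)) := Multiset.mem_map_of_mem _ hp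
      rw [hBm] at this
      simp only [Multiset.mem_add, Multiset.mem_replicate, Prod.mk.injEq] at this
      rcases this with (⟨_, a, b⟩ | ⟨_, a, b⟩) | ⟨_, a, b⟩ <;> rw [a, b] <;> decide
    · exact hX2 p hp
  · intro v
    rw [degE_add]
    have := hX3 v
    have := hcap v
    omega

/-- total colour function -/
def ccol (ℓ : Fin 3 → ℕ) (c : Vx ℓ → Fin 3) (k : Fin 3) (i : ℕ) : ℕ :=
  if h : i < ℓ k then (c ⟨k, ⟨i, h⟩⟩ : ℕ) else 3

theorem ccol_lt (ℓ : Fin 3 → ℕ) (c : Vx ℓ → Fin 3) (k : Fin 3) (i : ℕ) (h : i < ℓ k) :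
    ccol ℓ c k i = c ⟨k, ⟨i, h⟩⟩ := dif_pos h

theorem ccol_ge (ℓ : Fin 3 → ℕ) (c : Vx ℓ → Fin 3) (k : Fin 3) (i : ℕ) (h : ℓ k ≤ i) :
    ccol ℓ c k i = 3 := dif_neg (by omega)

theorem ccol_sum (ℓ : Fin 3 → ℕ) (c : Vx ℓ → Fin 3) (k : Fin 3) (a : ℕ) (h : ℓ k ≤ a)
    (j : Fin 3) : ∑ i : Fin (ℓ k), (if c ⟨k, i⟩ = j then 1 else 0) =
      ∑ i ∈ Finset.range a, if ccol ℓ c k i = j then 1 else 0 := by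
  rw [← Finset.sum_subset (Finset.range_mono h), ← Fin.sum_univ_eq_sum_range
    (fun i => if ccol ℓ c k i = j then 1 else 0)]
  · refine Finset.sum_congr rfl (fun i _ => ?_)
    rw [ccol_lt ℓ c k i i.2]
    simp [Fin.ext_iff]
  · intro i _ hi
    rw [Finset.mem_range, not_lt] at hi
    rw [ccol_ge _ _ _ _ hi, if_neg]
    have := j.2
    omega

theorem coloring_graph (ℓ : Fin 3 → ℕ) (h1 : ℓ 1 < ℓ 0) (h2 : ℓ 2 < ℓ 1) (c : Vx ℓ → Fin 3)
    (hc : ∀ p ∈ baseE ℓ h1 h2, c p.1 ≠ c p.2) :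
    content c 0 ≤ ℓ 0 ∧ (content c 0 = ℓ 0 → content c 1 ≤ ℓ 1 ∧
      (content c 1 = ℓ 1 → c = Sigma.fst)) := by
  have H1 : ∀ (k k' : Fin 3) (h : ℓ k' < ℓ k), edgeM ℓ k k' h ≤ baseE ℓ h1 h2 → ∀ i, i < ℓ k' →
      ccol ℓ c k i ≠ ccol ℓ c k' i := by
    intro k k' h hle i hi
    rw [ccol_lt _ _ _ _ hi, ccol_lt _ _ _ _ (hi.trans h)]
    intro he
    exact hc _ (Multiset.mem_of_le hle (edgeM_mem1 ℓ k k' h i hi)) (Fin.ext he)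
  have H2 : ∀ (k k' : Fin 3) (h : ℓ k' < ℓ k), edgeM ℓ k k' h ≤ baseE ℓ h1 h2 → ∀ i, i < ℓ k' →
      ccol ℓ c k (i + 1) ≠ ccol ℓ c k' i := by
    intro k k' h hle i hi
    rw [ccol_lt _ _ _ _ hi, ccol_lt _ _ _ (i + 1) (by omega)]
    intro he
    exact hc _ (Multiset.mem_of_le hle (edgeM_mem2 ℓ k k' h i hi)) (Fin.ext he)
  have l01 : edgeM ℓ 0 1 h1 ≤ baseE ℓ h1 h2 :=
    (Multiset.le_add_right _ _).trans (Multiset.le_add_right _ _)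
  have l02 : edgeM ℓ 0 2 (h2.trans h1) ≤ baseE ℓ h1 h2 :=
    (Multiset.le_add_left _ _).trans (Multiset.le_add_right _ _)
  have l12 : edgeM ℓ 1 2 h2 ≤ baseE ℓ h1 h2 := Multiset.le_add_left _ _
  have hcont : ∀ j : Fin 3, content c j = ∑ i ∈ Finset.range (ℓ 0),
      ((if ccol ℓ c 0 i = j then 1 else 0) + (if ccol ℓ c 1 i = j then 1 else 0) +
        (if ccol ℓ c 2 i = j then 1 else 0)) := by
    intro j
    rw [content_apply, Finset.card_filter, Fintype.sum_sigma, Fin.sum_univ_three,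
      ccol_sum ℓ c 0 (ℓ 0) le_rfl, ccol_sum ℓ c 1 (ℓ 0) h1.le, ccol_sum ℓ c 2 (ℓ 0) (h2.trans h1).le,
      Finset.sum_add_distrib, Finset.sum_add_distrib]
  have key := coloring (ℓ 0) (ℓ 1) (ℓ 2) h1 h2 (ccol ℓ c 0) (ccol ℓ c 1) (ccol ℓ c 2)
    (fun i hi => ccol_ge _ _ _ _ hi) (fun i hi => ccol_ge _ _ _ _ hi)
    (fun i hi => by
      rw [ccol_lt _ _ _ _ hi]
      have := (c ⟨2, ⟨i, hi⟩⟩).2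
      omega)
    (H1 0 1 h1 l01) (H2 0 1 h1 l01) (H1 0 2 _ l02) (H2 0 2 _ l02) (H1 1 2 h2 l12) (H2 1 2 h2 l12)
    (fun j => if h : j < 3 then content c ⟨j, h⟩ else 0)
    (by
      intro j hj
      rw [dif_pos (by omega), hcont])
  simp only [Nat.ofNat_pos, Nat.one_lt_ofNat, dif_pos] at key
  refine ⟨key.1, fun e0 => ⟨(key.2 e0).1, fun e1 => ?_⟩⟩
  obtain ⟨r0, r1, r2⟩ := (key.2 e0).2 e1
  funext ⟨k, i⟩
  apply Fin.ext
  match k, i with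
  | 0, i => exact (ccol_lt ℓ c 0 i i.2).symm.trans (r0 i i.2)
  | 1, i => exact (ccol_lt ℓ c 1 i i.2).symm.trans (r1 i i.2)
  | 2, i => exact (ccol_lt ℓ c 2 i i.2).symm.trans (r2 i i.2)

/-- evaluation points -/
def zpt : Fin 3 → ℚ := fun a => ((a : ℕ) : ℚ)

theorem zpt_inj : Function.Injective zpt := by
  intro a b h
  have h' : ((a : ℕ) : ℚ) = ((b : ℕ) : ℚ) := h
  exact Fin.ext (by exact_mod_cast h')

theorem exists_vec (m n r : ℕ) (ℓ : Fin 3 → ℕ) (hm : 4 ≤ m) (h1 : ℓ 1 < ℓ 0) (h2 : ℓ 2 < ℓ 1)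
    (hn : ℓ 0 + ℓ 1 + ℓ 2 = n)
    (hr : 2 * ℓ 1 + 4 * ℓ 2 ≤ r) (hr2 : 2 * r ≤ m * n)
    (hl : m * ℓ 0 + 4 * ℓ 2 ≤ m * ℓ 1 + m * ℓ 2 + 1) :
    ∃ p ∈ VS m n r, lowD p = 0 ∧ ell zpt (Finsupp.equivFunOnFinite.symm ℓ) p ≠ 0 ∧
      ∀ ν, ell zpt ν p ≠ 0 → ν 0 ≤ ℓ 0 ∧ (ν 0 = ℓ 0 → ν 1 ≤ ℓ 1) := by
  subst hn
  obtain ⟨E, hBE, hEc, hEp, hEd⟩ := exists_graph m r ℓ hm h1 h2 hr hr2 hl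
  have hcard : Fintype.card (Vx ℓ) = ℓ 0 + ℓ 1 + ℓ 2 := by
    rw [Fintype.card_sigma]
    simp [Fin.sum_univ_three]
  refine ⟨Psi (PE E), ?_, ?_, ?_, ?_⟩
  · have := Psi_PE_mem E m hEd
    rwa [hcard, hEc] at this
  · rw [lowD_Psi, transD_PE, map_zero]
  · rw [ell_Psi, Finset.sum_eq_single (Sigma.fst : Vx ℓ → Fin 3)]
    · rw [if_pos]
      · rw [eval_PE_ne E zpt zpt_inj]
        exact hEp
      · ext k
        rw [content_apply, card_class]
        rfl
    · intro c _ hc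
      split_ifs with hcon
      · by_contra hne
        have hp := (eval_PE_ne E zpt zpt_inj c).mp hne
        have := coloring_graph ℓ h1 h2 c (fun p hpm => hp p (Multiset.mem_of_le hBE hpm))
        have k0 : content c 0 = ℓ 0 := by rw [hcon]; rfl
        have k1 : content c 1 = ℓ 1 := by rw [hcon]; rfl
        exact hc ((this.2 k0).2 k1)
      · rfl
    · simp
  · intro ν hν
    rw [ell_Psi] at hν
    obtain ⟨c, _, hc⟩ := Finset.exists_ne_zero_of_sum_ne_zero hν
    split_ifs at hc with hcon
    · have hp := (eval_PE_ne E zpt zpt_inj c).mp hc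
      have := coloring_graph ℓ h1 h2 c (fun p hpm => hp p (Multiset.mem_of_le hBE hpm))
      rw [hcon] at this
      exact ⟨this.1, fun h => (this.2 h).1⟩
    · exact absurd rfl hc

theorem stmt9 (m n r : ℕ) (hm : 4 ≤ m) (hn : 0 < n)
    (hr1 : max 1 (2 * n - 4) ≤ r) (hr2 : 2 * r ≤ m * n) :
    gaussP m n (r - 1) +
      Set.ncard {t : ℕ × ℕ × ℕ | 0 < t.1 ∧ 0 < t.2.1 ∧ 0 < t.2.2 ∧
        t.1 + 2 * t.2.1 + 3 * t.2.2 = n ∧ m * t.1 ≤ (m - 4) * t.2.2 + 1} ≤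
    gaussP m n r := by
  set T : Set (ℕ × ℕ × ℕ) := {t : ℕ × ℕ × ℕ | 0 < t.1 ∧ 0 < t.2.1 ∧ 0 < t.2.2 ∧
        t.1 + 2 * t.2.1 + 3 * t.2.2 = n ∧ m * t.1 ≤ (m - 4) * t.2.2 + 1} with hT
  have hfin : T.Finite := by
    apply (Set.finite_Iic ((n, n, n) : ℕ × ℕ × ℕ)).subset
    rintro ⟨x, y, w⟩ ⟨_, _, _, h, _⟩
    simp only at h
    refine ⟨?_, ?_, ?_⟩ <;> simp only <;> omega
  have : Finite T := hfin
  let lam : T → Fin 3 → ℕ := fun t => ![t.1.1 + t.1.2.1 + t.1.2.2, t.1.2.1 + t.1.2.2, t.1.2.2]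
  have hex : ∀ t : T, ∃ p ∈ VS m n r, lowD p = 0 ∧
      ell zpt (Finsupp.equivFunOnFinite.symm (lam t)) p ≠ 0 ∧
      ∀ ν, ell zpt ν p ≠ 0 → ν 0 ≤ lam t 0 ∧ (ν 0 = lam t 0 → ν 1 ≤ lam t 1) := by
    rintro ⟨⟨d0, d1, d2⟩, p0, p1, p2, hs, hd⟩
    simp only at p0 p1 p2 hs hd
    have hr3 : 2 * n - 4 ≤ r := (le_max_right _ _).trans hr1
    apply exists_vec m n r _ hm
    · change d1 + d2 < d0 + d1 + d2
      omega
    · change d2 < d1 + d2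
      omega
    · change d0 + d1 + d2 + (d1 + d2) + d2 = n
      omega
    · change 2 * (d1 + d2) + 4 * d2 ≤ r
      omega
    · exact hr2
    · change m * (d0 + d1 + d2) + 4 * d2 ≤ m * (d1 + d2) + m * d2 + 1
      obtain ⟨q, rfl⟩ := Nat.exists_eq_add_of_le hm
      rw [Nat.add_sub_cancel_left] at hd
      linarith
  choose v hv1 hv2 hv3 hv4 using hex
  have hinj : ∀ s t : T, lam s 0 = lam t 0 → lam s 1 = lam t 1 → s = t := by
    rintro ⟨⟨d0, d1, d2⟩, p0, p1, p2, hs, hd⟩ ⟨⟨d0', d1', d2'⟩, p0', p1', p2', hs', hd'⟩ e0 e1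
    change d0 + d1 + d2 = d0' + d1' + d2' at e0
    change d1 + d2 = d1' + d2' at e1
    simp only at hs hs'
    simp only [Subtype.mk.injEq, Prod.mk.injEq]
    omega
  have hli : LinearIndependent ℚ v := by
    rw [linearIndependent_iff']
    intro s g hg
    by_contra hne
    push Not at hne
    obtain ⟨i0, hi0, hgi0⟩ := hne
    obtain ⟨t, ht, hmax⟩ := Finset.exists_max_image (s.filter (fun i => g i ≠ 0))
      (fun i => toLex (lam i 0, lam i 1)) ⟨i0, by simp [hi0, hgi0]⟩
    rw [Finset.mem_filter] at ht
    have h := congrArg (ell zpt (Finsupp.equivFunOnFinite.symm (lam t))) hg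
    rw [map_sum, map_zero, Finset.sum_eq_single t] at h
    · rw [map_smul, smul_eq_mul, mul_eq_zero] at h
      rcases h with h | h
      · exact ht.2 h
      · exact hv3 t h
    · intro b hb hbt
      rw [map_smul, smul_eq_mul, mul_eq_zero]
      by_contra hc
      push Not at hc
      have k1 := hv4 b _ hc.2
      have k2 := hmax b (by simp [hb, hc.1])
      rw [Prod.Lex.toLex_le_toLex] at k2
      have k3 : lam t 0 ≤ lam b 0 := k1.1
      have k4 : lam t 0 = lam b 0 → lam t 1 ≤ lam b 1 := k1.2
      simp only at k2
      have e0 : lam b 0 = lam t 0 := by omega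
      have e1 : lam b 1 = lam t 1 := by omega
      exact hbt (hinj b t e0 e1)
    · intro hc
      exact absurd ht.1 hc
  have hr0 : 1 ≤ r := (le_max_left _ _).trans hr1
  obtain ⟨r, rfl⟩ := Nat.exists_eq_add_of_le' hr0
  have := main_bound_s9 m n r (by omega) v hv1 hv2 hli
  exact this
end
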